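/- arXiv:1404.7036 — 9 statements merged into one kernel-verified Lean document; each statement's English description precedes it below -/
import Mathlib

section
/- Let R > 0 and let n ≥ 0 be a real number. Let r : ℝ → ℝ be continuously differentiable on [0,R] with r(x) ≥ 0 and r'(x) > 0 for all x ∈ [0,R], and let u : ℝ → ℂ be continuously differentiable on [0,R] with u(R) = 0. Then ∫₀^R r(x)^n · r'(x) · |u(x)|² dx ≤ (4/(1+n)²) · ∫₀^R r(x)^(n+2) · r'(x)⁻¹ · |u'(x)|² dx. -/
open Set MeasureTheory

/-- First Hardy inequality (Lemma 3.1 of the paper), in the tortoise coordinate: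
`r` is the area-radius function with `dr/dr* = r' > 0`, `u` vanishes at the outer
endpoint `R`, and for any real `n ≥ 0`,
`∫₀^R rⁿ r' |u|² ≤ (4/(1+n)²) ∫₀^R r^{n+2} (r')⁻¹ |u'|²`. -/
theorem hardy_inequality_inner
    (R : ℝ) (hR : 0 < R) (n : ℝ) (hn : 0 ≤ n)
    (r r' : ℝ → ℝ) (u u' : ℝ → ℂ)
    (hr : ∀ x ∈ Icc (0:ℝ) R, HasDerivWithinAt r (r' x) (Icc (0:ℝ) R) x)
    (hr'cont : ContinuousOn r' (Icc (0:ℝ) R))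
    (hrnonneg : ∀ x ∈ Icc (0:ℝ) R, 0 ≤ r x)
    (hr'pos : ∀ x ∈ Icc (0:ℝ) R, 0 < r' x)
    (hu : ∀ x ∈ Icc (0:ℝ) R, HasDerivWithinAt u (u' x) (Icc (0:ℝ) R) x)
    (hu'cont : ContinuousOn u' (Icc (0:ℝ) R))
    (huR : u R = 0) :
    ∫ x in (0:ℝ)..R, r x ^ n * r' x * ‖u x‖ ^ 2
      ≤ (4 / (1 + n) ^ 2) * ∫ x in (0:ℝ)..R, r x ^ (n + 2) * (r' x)⁻¹ * ‖u' x‖ ^ 2 := by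
  have hm : 0 < 1 + n := by linarith
  have hrc : ContinuousOn r (Icc (0:ℝ) R) := fun x hx => (hr x hx).continuousWithinAt
  have huc : ContinuousOn u (Icc (0:ℝ) R) := fun x hx => (hu x hx).continuousWithinAt
  have hrp : ∀ p : ℝ, 0 ≤ p → ContinuousOn (fun x => r x ^ p) (Icc (0:ℝ) R) :=
    fun p hp => hrc.rpow_const (fun x _ => Or.inr hp)
  have hri : ContinuousOn (fun x => (r' x)⁻¹) (Icc (0:ℝ) R) :=
    hr'cont.inv₀ (fun x hx => (hr'pos x hx).ne')
  have hA : ContinuousOn (fun x => r x ^ n * r' x * ‖u x‖ ^ 2) (Icc (0:ℝ) R) :=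
    ((hrp n hn).mul hr'cont).mul (huc.norm.pow 2)
  have hB : ContinuousOn (fun x => r x ^ (n + 2) * (r' x)⁻¹ * ‖u' x‖ ^ 2) (Icc (0:ℝ) R) :=
    ((hrp (n + 2) (by linarith)).mul hri).mul (hu'cont.norm.pow 2)
  set D : ℝ → ℝ := fun x => 2 / (1 + n) * ((r' x * (n + 1) * r x ^ (n + 1 - 1)) * ‖u x‖ ^ 2
    + r x ^ (n + 1) * (2 * inner ℝ (u x) (u' x))) with hD
  have hDc : ContinuousOn D (Icc (0:ℝ) R) :=
    continuousOn_const.mul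
      ((((hr'cont.mul continuousOn_const).mul (hrp _ (by linarith))).mul (huc.norm.pow 2)).add
        ((hrp _ (by linarith)).mul (continuousOn_const.mul (ContinuousOn.inner (𝕜 := ℝ) huc hu'cont))))
  have hG : ∀ x ∈ Icc (0:ℝ) R,
      HasDerivWithinAt (fun x => 2 / (1 + n) * (r x ^ (n + 1) * ‖u x‖ ^ 2)) (D x)
        (Icc (0:ℝ) R) x := fun x hx =>
    (((hr x hx).rpow_const (Or.inr (by linarith))).mul (hu x hx).norm_sq).const_mul _
  have iD : IntervalIntegrable D volume 0 R := by
    apply ContinuousOn.intervalIntegrable; rwa [uIcc_of_le hR.le]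
  have iA : IntervalIntegrable (fun x => r x ^ n * r' x * ‖u x‖ ^ 2) volume 0 R := by
    apply ContinuousOn.intervalIntegrable; rwa [uIcc_of_le hR.le]
  have iB : IntervalIntegrable (fun x => r x ^ (n + 2) * (r' x)⁻¹ * ‖u' x‖ ^ 2) volume 0 R := by
    apply ContinuousOn.intervalIntegrable; rwa [uIcc_of_le hR.le]
  have hF := intervalIntegral.integral_eq_sub_of_hasDerivAt_of_le hR.le
    (fun x hx => (hG x hx).continuousWithinAt)
    (fun x hx => (hG x (Ioo_subset_Icc_self hx)).hasDerivAt (Icc_mem_nhds hx.1 hx.2)) iD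
  have h0 : 0 ≤ 2 / (1 + n) * (r 0 ^ (n + 1) * ‖u 0‖ ^ 2) := by
    have := Real.rpow_nonneg (hrnonneg 0 ⟨le_rfl, hR.le⟩) (n + 1)
    positivity
  have hneg : ∫ x in (0:ℝ)..R, D x ≤ 0 := by
    rw [hF]; simp only [huR, norm_zero]; simp; simpa using h0
  have hmono := intervalIntegral.integral_mono_on hR.le iA
    ((iB.const_mul (4 / (1 + n) ^ 2)).add iD) (fun x hx => by
      have hr0 := hrnonneg x hx
      have hp := hr'pos x hx
      have e1 : r x ^ (n + 1) = r x ^ n * r x := Real.rpow_add_one' hr0 (by linarith)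
      have e2 : r x ^ (n + 2) = r x ^ n * r x ^ 2 := by
        rw [Real.rpow_add' hr0 (by linarith)]; norm_num
      have hI : 0 ≤ inner ℝ (u x) (u' x) + ‖u x‖ * ‖u' x‖ := by
        have := neg_le_of_abs_le (abs_real_inner_le_norm (u x) (u' x))
        linarith
      have hP := Real.rpow_nonneg hr0 n
      have key : 0 ≤ r x ^ n * r' x * (‖u x‖ - 2 * r x * ‖u' x‖ / ((1 + n) * r' x)) ^ 2
          + 4 * (r x ^ n) * r x * (inner ℝ (u x) (u' x) + ‖u x‖ * ‖u' x‖) / (1 + n) := by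
        positivity
      simp only [hD, e1, e2, add_sub_cancel_right]
      rw [← sub_nonneg]
      refine key.trans_eq ?_
      generalize (inner ℝ (u x) (u' x) : ℝ) = I
      have hne := hp.ne'
      have hmne := hm.ne'
      field_simp
      ring)
  rw [intervalIntegral.integral_add (iB.const_mul _) iD,
    intervalIntegral.integral_const_mul] at hmono
  linarith
end

section
/- Let R ∈ ℝ and let n > 1 be a real number. Let r : ℝ → ℝ be continuously differentiable on [R,∞) with r(x) > 0 and r'(x) > 0 for all x ≥ R, and let u : ℝ → ℂ be continuously differentiable on [R,∞) with u(R) = 0 and r(x)^(1−n)|u(x)|² → 0 as x → ∞. Assume the functions x ↦ r(x)^(−n) r'(x)|u(x)|² and x ↦ r(x)^(2−n) r'(x)⁻¹|u'(x)|² are integrable on [R,∞). Then ∫_R^∞ r(x)^(−n) · r'(x) · |u(x)|² dx ≤ (4/(n−1)²) · ∫_R^∞ r(x)^(2−n) · r'(x)⁻¹ · |u'(x)|² dx. -/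
open Set MeasureTheory Filter

theorem hardy_pointwise (p q s a b c i : ℝ) (hp : 0 < p) (hs : 0 < s) (hc : 0 < c)
    (hi : |i| ≤ a * b) (hq : 0 < q) :
    |p * q * (2 * i)| ≤ c * (p * s * a ^ 2) + c⁻¹ * (p * q ^ 2 * s⁻¹ * b ^ 2) := by
  have h1 : |p * q * (2 * i)| ≤ p * q * (2 * (a * b)) := by
    rw [abs_mul, abs_of_pos (mul_pos hp hq), abs_mul, abs_two]
    gcongr
  have h2 : c * (p * s * a ^ 2) + c⁻¹ * (p * q ^ 2 * s⁻¹ * b ^ 2) - p * q * (2 * (a * b))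
      = p / (c * s) * (c * s * a - q * b) ^ 2 := by
    field_simp
    ring
  have h3 : 0 ≤ p / (c * s) * (c * s * a - q * b) ^ 2 := by positivity
  linarith

/-- Second Hardy inequality (Lemma 3.1 of the paper), in the tortoise coordinate:
`r` is the area-radius function with `dr/dr* = r' > 0` on `[R,∞)`, `u` vanishes at the
inner endpoint `R` and `r^{1-n}|u|² → 0` at infinity; then for any real `n > 1`,
`∫_R^∞ r^{-n} r' |u|² ≤ (4/(n-1)²) ∫_R^∞ r^{2-n} (r')⁻¹ |u'|²`. -/
theorem hardy_inequality_outer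
    (R : ℝ) (n : ℝ) (hn : 1 < n)
    (r r' : ℝ → ℝ) (u u' : ℝ → ℂ)
    (hr : ∀ x ∈ Ici R, HasDerivWithinAt r (r' x) (Ici R) x)
    (hr'cont : ContinuousOn r' (Ici R))
    (hrpos : ∀ x ∈ Ici R, 0 < r x)
    (hr'pos : ∀ x ∈ Ici R, 0 < r' x)
    (hu : ∀ x ∈ Ici R, HasDerivWithinAt u (u' x) (Ici R) x)
    (hu'cont : ContinuousOn u' (Ici R))
    (huR : u R = 0)
    (hlim : Tendsto (fun x => r x ^ (1 - n) * ‖u x‖ ^ 2) atTop (nhds 0))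
    (hint1 : IntegrableOn (fun x => r x ^ (-n) * r' x * ‖u x‖ ^ 2) (Ici R))
    (hint2 : IntegrableOn (fun x => r x ^ (2 - n) * (r' x)⁻¹ * ‖u' x‖ ^ 2) (Ici R)) :
    ∫ x in Ici R, r x ^ (-n) * r' x * ‖u x‖ ^ 2
      ≤ (4 / (n - 1) ^ 2) * ∫ x in Ici R, r x ^ (2 - n) * (r' x)⁻¹ * ‖u' x‖ ^ 2 := by
  have hc : 0 < (n - 1) / 2 := by linarith
  have hrc : ContinuousOn r (Ici R) := fun x hx => (hr x hx).continuousWithinAt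
  have huc : ContinuousOn u (Ici R) := fun x hx => (hu x hx).continuousWithinAt
  have hpc : ∀ m : ℝ, ContinuousOn (fun x => r x ^ m) (Ici R) := fun m =>
    hrc.rpow_const (fun x hx => Or.inl (hrpos x hx).ne')
  have e1 : ∀ x ∈ Ici R, r x ^ (1 - n) = r x ^ (-n) * r x := fun x hx => by
    rw [show 1 - n = -n + 1 by ring, Real.rpow_add_one (hrpos x hx).ne']
  have e2 : ∀ x ∈ Ici R, r x ^ (2 - n) = r x ^ (-n) * r x ^ 2 := fun x hx => by
    rw [show 2 - n = -n + (2 : ℕ) by push_cast; ring, Real.rpow_add_natCast (hrpos x hx).ne']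
  have hpt : ∀ x ∈ Ici R, |r x ^ (1 - n) * (2 * inner ℝ (u x) (u' x))| ≤
      (n - 1) / 2 * (r x ^ (-n) * r' x * ‖u x‖ ^ 2)
        + ((n - 1) / 2)⁻¹ * (r x ^ (2 - n) * (r' x)⁻¹ * ‖u' x‖ ^ 2) := fun x hx => by
    rw [e1 x hx, e2 x hx]
    exact hardy_pointwise _ _ _ _ _ _ _ (Real.rpow_pos_of_pos (hrpos x hx) _) (hr'pos x hx) hc
      (abs_real_inner_le_norm _ _) (hrpos x hx)
  have hbd := (hint1.const_mul ((n - 1) / 2)).add (hint2.const_mul ((n - 1) / 2)⁻¹)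
  have hI : IntegrableOn (fun x => r x ^ (1 - n) * (2 * inner ℝ (u x) (u' x))) (Ici R) := by
    refine Integrable.mono' hbd ?_ ?_
    · refine ContinuousOn.aestronglyMeasurable ?_ measurableSet_Ici
      exact (hpc _).mul (continuousOn_const.mul (huc.inner (𝕜 := ℝ) hu'cont))
    · filter_upwards [ae_restrict_mem measurableSet_Ici] with x hx
      exact hpt x hx
  have hD : IntegrableOn (fun x => (1 - n) * (r x ^ (-n) * r' x * ‖u x‖ ^ 2)
      + r x ^ (1 - n) * (2 * inner ℝ (u x) (u' x))) (Ici R) := (hint1.const_mul (1 - n)).add hI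
  have hftc : ∫ x in Ioi R, ((1 - n) * (r x ^ (-n) * r' x * ‖u x‖ ^ 2)
      + r x ^ (1 - n) * (2 * inner ℝ (u x) (u' x))) = 0 - r R ^ (1 - n) * ‖u R‖ ^ 2 := by
    refine integral_Ioi_of_hasDerivAt_of_tendsto (f := fun x => r x ^ (1 - n) * ‖u x‖ ^ 2)
      ?_ ?_ (hD.mono_set Ioi_subset_Ici_self) hlim
    · exact ((hpc _).mul (huc.norm.pow 2)) R self_mem_Ici
    · intro x hx
      have hxI : x ∈ Ici R := Ioi_subset_Ici_self hx
      have h1 := ((hr x hxI).hasDerivAt (Ici_mem_nhds hx)).rpow_const (p := 1 - n)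
        (Or.inl (hrpos x hxI).ne')
      have h2 := ((hu x hxI).hasDerivAt (Ici_mem_nhds hx)).norm_sq
      refine (h1.mul h2).congr_deriv ?_
      rw [show 1 - n - 1 = -n by ring]
      ring
  rw [← integral_Ici_eq_integral_Ioi, integral_add (hint1.const_mul _) hI, integral_const_mul, huR] at hftc
  have hle := setIntegral_mono_on hI hbd measurableSet_Ici
    (fun x hx => (le_abs_self _).trans (hpt x hx))
  simp only [Pi.add_apply] at hle
  rw [integral_add (hint1.const_mul _) (hint2.const_mul _), integral_const_mul,
    integral_const_mul] at hle
  simp only [norm_zero] at hftc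
  generalize (∫ x in Ici R, r x ^ (-n) * r' x * ‖u x‖ ^ 2) = A at *
  generalize (∫ x in Ici R, r x ^ (2 - n) * (r' x)⁻¹ * ‖u' x‖ ^ 2) = B at *
  have h3 : (n - 1) / 2 * A ≤ ((n - 1) / 2)⁻¹ * B := by
    norm_num at hftc
    norm_num at hle ⊢
    linarith
  have h4 := mul_le_mul_of_nonneg_left h3 (inv_pos.mpr hc).le
  rw [inv_mul_cancel_left₀ hc.ne'] at h4
  refine h4.trans (le_of_eq ?_)
  have : n - 1 ≠ 0 := by linarith
  field_simp
  ring
end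

section
/- Let x₁ < x₂ be real numbers, h > 0, and let u, W, φ : ℝ → ℝ be smooth on [x₁,x₂] with u(x₁) = u(x₂) = 0. Then ∫_{x₁}^{x₂} [ ( (e^{φ(x)/h} u(x))' )² + h⁻² (W(x) − φ'(x)²) e^{2φ(x)/h} u(x)² ] dx = ∫_{x₁}^{x₂} ( −u''(x) + h⁻² W(x) u(x) ) · u(x) · e^{2φ(x)/h} dx. -/
open Set MeasureTheory

/-- The weighted integration-by-parts energy identity (Lemma 4.3 of the paper):
for smooth `u`, `W`, `φ` on `[x₁,x₂]` with `u(x₁) = u(x₂) = 0` and `h > 0`,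
`∫ ((e^{φ/h}u)')² + h⁻²(W − (φ')²) e^{2φ/h} u² = ∫ (−u'' + h⁻² W u) u e^{2φ/h}`,
where all derivatives are taken within `[x₁,x₂]`. -/
theorem weighted_energy_identity
    (x₁ x₂ h : ℝ) (hx : x₁ < x₂) (hh : 0 < h)
    (u W φ : ℝ → ℝ)
    (hu : ContDiffOn ℝ (⊤ : ℕ∞) u (Icc x₁ x₂))
    (hW : ContDiffOn ℝ (⊤ : ℕ∞) W (Icc x₁ x₂))
    (hφ : ContDiffOn ℝ (⊤ : ℕ∞) φ (Icc x₁ x₂))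
    (hu₁ : u x₁ = 0) (hu₂ : u x₂ = 0) :
    ∫ x in x₁..x₂,
        ((derivWithin (fun y => Real.exp (φ y / h) * u y) (Icc x₁ x₂) x) ^ 2
          + (1 / h ^ 2) * (W x - (derivWithin φ (Icc x₁ x₂) x) ^ 2)
              * Real.exp (2 * φ x / h) * (u x) ^ 2)
      = ∫ x in x₁..x₂,
          (-(derivWithin (derivWithin u (Icc x₁ x₂)) (Icc x₁ x₂) x)
              + (1 / h ^ 2) * W x * u x) * u x * Real.exp (2 * φ x / h) := by
  have hU : UniqueDiffOn ℝ (Icc x₁ x₂) := uniqueDiffOn_Icc hx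
  have hu' : ContDiffOn ℝ (⊤ : ℕ∞) (derivWithin u (Icc x₁ x₂)) (Icc x₁ x₂) :=
    hu.derivWithin hU (by simp)
  have hu'' : ContDiffOn ℝ (⊤ : ℕ∞)
      (derivWithin (derivWithin u (Icc x₁ x₂)) (Icc x₁ x₂)) (Icc x₁ x₂) :=
    hu'.derivWithin hU (by simp)
  have hE : ContDiffOn ℝ (⊤ : ℕ∞) (fun x => Real.exp (2 * φ x / h)) (Icc x₁ x₂) :=
    ((contDiffOn_const.mul hφ).div_const h).exp
  have hG : ContDiffOn ℝ (⊤ : ℕ∞)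
      (fun x => Real.exp (2 * φ x / h) * (u x * derivWithin u (Icc x₁ x₂) x))
      (Icc x₁ x₂) := hE.mul (hu.mul hu')
  have hG' := hG.derivWithin (m := (⊤ : ℕ∞)) hU (by simp)
  have hR : ContinuousOn (fun x =>
      (-(derivWithin (derivWithin u (Icc x₁ x₂)) (Icc x₁ x₂) x)
              + (1 / h ^ 2) * W x * u x) * u x * Real.exp (2 * φ x / h)) (Icc x₁ x₂) :=
    (((hu''.continuousOn.neg).add ((continuousOn_const.mul hW.continuousOn).mul
      hu.continuousOn)).mul hu.continuousOn).mul hE.continuousOn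
  have hI := intervalIntegral.integral_derivWithin_Icc_of_contDiffOn_Icc
    (hG.of_le (by exact_mod_cast le_top)) hx.le
  simp only [hu₁, hu₂, zero_mul, mul_zero, sub_zero] at hI
  rw [← add_zero (∫ x in x₁..x₂, (-(derivWithin (derivWithin u (Icc x₁ x₂)) (Icc x₁ x₂) x)
              + (1 / h ^ 2) * W x * u x) * u x * Real.exp (2 * φ x / h)), ← hI,
    ← intervalIntegral.integral_add (hR.intervalIntegrable_of_Icc hx.le)
      (hG'.continuousOn.intervalIntegrable_of_Icc hx.le)]
  apply intervalIntegral.integral_congr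
  intro x hxm
  rw [uIcc_of_le hx.le] at hxm
  have du := (hu.differentiableOn (by simp) x hxm).hasDerivWithinAt
  have du' := (hu'.differentiableOn (by simp) x hxm).hasDerivWithinAt
  have dφ := (hφ.differentiableOn (by simp) x hxm).hasDerivWithinAt
  have d1 := ((dφ.div_const h).exp.mul du).derivWithin (hU x hxm)
  have d2 := (((dφ.const_mul 2).div_const h).exp.mul (du.mul du')).derivWithin (hU x hxm)
  have e2 : Real.exp (2 * φ x / h) = Real.exp (φ x / h) ^ 2 := by
    rw [← Real.exp_nat_mul]; congr 1; push_cast; ring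
  simp only [Pi.mul_def] at d1 d2
  simp only [d1, d2, e2]
  field_simp
  ring
end

section
/- Let x₁ < x₂, let h > 0, ε > 0, κ ≥ 0, and a ≥ 0 be real numbers. Let V : ℝ → ℝ be continuous on [x₁,x₂] and let u : ℝ → ℝ be twice continuously differentiable on [x₁,x₂] with u(x₁) = u(x₂) = 0 and −h²u''(x) + V(x)u(x) = κu(x) for all x ∈ [x₁,x₂]. Let φ : ℝ → ℝ be continuously differentiable on [x₁,x₂] with φ ≥ 0, and set Ω₊ := {x ∈ [x₁,x₂] : V(x) > κ + ε} and Ω₋ := {x ∈ [x₁,x₂] : V(x) ≤ κ + ε}. Assume that V(x) − κ − φ'(x)² ≥ ε² for all x ∈ Ω₊, and that φ(x) ≤ a and κ − V(x) + φ'(x)² ≤ κ + ε for all x ∈ Ω₋. Then h² ∫_{x₁}^{x₂} ( (e^{φ(x)/h} u(x))' )² dx + ε² ∫_{Ω₊} e^{2φ(x)/h} u(x)² dx ≤ (κ + ε) e^{2a/h} ∫_{x₁}^{x₂} u(x)² dx. -/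
open Set MeasureTheory

/-- The main Agmon-type estimate (Lemma 4.4 of the paper) for Dirichlet eigenfunctions of
the semiclassical Schrödinger operator `−h²(d/dx)² + V` on `[x₁,x₂]`, with weight `φ`
(in the paper `φ = (1−ε)d_κ` with `d_κ` the Agmon distance): with
`Ω₊ = {x ∈ [x₁,x₂] : V(x) > κ + ε}`, `Ω₋ = {x ∈ [x₁,x₂] : V(x) ≤ κ + ε}`,
`h² ∫ ((e^{φ/h}u)')² + ε² ∫_{Ω₊} e^{2φ/h} u² ≤ (κ+ε) e^{2a/h} ∫ u²`. -/
theorem agmon_estimate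
    (x₁ x₂ h ε κ a : ℝ) (hx : x₁ < x₂) (hh : 0 < h) (hε : 0 < ε)
    (hκ : 0 ≤ κ) (ha : 0 ≤ a)
    (V : ℝ → ℝ) (hV : ContinuousOn V (Icc x₁ x₂))
    (u u' u'' : ℝ → ℝ)
    (hu : ∀ x ∈ Icc x₁ x₂, HasDerivWithinAt u (u' x) (Icc x₁ x₂) x)
    (hu' : ∀ x ∈ Icc x₁ x₂, HasDerivWithinAt u' (u'' x) (Icc x₁ x₂) x)
    (hu''cont : ContinuousOn u'' (Icc x₁ x₂))
    (hbc₁ : u x₁ = 0) (hbc₂ : u x₂ = 0)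
    (heq : ∀ x ∈ Icc x₁ x₂, -h ^ 2 * u'' x + V x * u x = κ * u x)
    (φ φ' : ℝ → ℝ)
    (hφ : ∀ x ∈ Icc x₁ x₂, HasDerivWithinAt φ (φ' x) (Icc x₁ x₂) x)
    (hφ'cont : ContinuousOn φ' (Icc x₁ x₂))
    (hφnonneg : ∀ x ∈ Icc x₁ x₂, 0 ≤ φ x)
    (hΩp : ∀ x ∈ Icc x₁ x₂, κ + ε < V x → ε ^ 2 ≤ V x - κ - (φ' x) ^ 2)
    (hΩm : ∀ x ∈ Icc x₁ x₂, V x ≤ κ + ε →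
            φ x ≤ a ∧ κ - V x + (φ' x) ^ 2 ≤ κ + ε) :
    h ^ 2 * (∫ x in x₁..x₂,
        (Real.exp (φ x / h) * ((φ' x / h) * u x + u' x)) ^ 2)
      + ε ^ 2 * (∫ x in {x | x ∈ Icc x₁ x₂ ∧ κ + ε < V x},
          Real.exp (2 * φ x / h) * (u x) ^ 2)
      ≤ (κ + ε) * Real.exp (2 * a / h) * ∫ x in x₁..x₂, (u x) ^ 2 := by
  have hle := hx.le
  have cu : ContinuousOn u (Icc x₁ x₂) := fun x hx => (hu x hx).continuousWithinAt
  have cu' : ContinuousOn u' (Icc x₁ x₂) := fun x hx => (hu' x hx).continuousWithinAt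
  have cφ : ContinuousOn φ (Icc x₁ x₂) := fun x hx => (hφ x hx).continuousWithinAt
  have hne : h ≠ 0 := hh.ne'
  let W : ℝ → ℝ := fun x => Real.exp (2 * φ x / h) * (u x * u' x)
  let W' : ℝ → ℝ := fun x => Real.exp (2 * φ x / h) * (2 * φ' x / h) * (u x * u' x)
    + Real.exp (2 * φ x / h) * (u' x * u' x + u x * u'' x)
  have cW : ContinuousOn W (Icc x₁ x₂) := by
    simp only [W]; fun_prop
  have cW' : ContinuousOn W' (Icc x₁ x₂) := by
    simp only [W']; fun_prop
  have hWint : ∫ x in x₁..x₂, W' x = 0 := by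
    rw [intervalIntegral.integral_eq_sub_of_hasDerivAt_of_le hle cW]
    · simp [W, hbc₁, hbc₂]
    · intro x hx
      have hm : Icc x₁ x₂ ∈ nhds x := Icc_mem_nhds hx.1 hx.2
      have hxI := Ioo_subset_Icc_self hx
      have d1 := (hu x hxI).hasDerivAt hm
      have d2 := (hu' x hxI).hasDerivAt hm
      have d3 := (hφ x hxI).hasDerivAt hm
      exact (((d3.const_mul 2).div_const h).exp).mul (d1.mul d2)
    · exact cW'.intervalIntegrable_of_Icc hle
  have hIW : IntegrableOn W' (Icc x₁ x₂) := cW'.integrableOn_Icc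
  set S : Set ℝ := {x | x ∈ Icc x₁ x₂ ∧ κ + ε < V x} with hS
  have hSm : MeasurableSet S := by
    obtain ⟨t, ht, h2⟩ := (continuousOn_iff'.1 hV) (Ioi (κ + ε)) isOpen_Ioi
    have : S = t ∩ Icc x₁ x₂ := by
      rw [← h2]; ext x; simp [hS, and_comm]
    rw [this]
    exact ht.measurableSet.inter measurableSet_Icc
  have hSsub : Icc x₁ x₂ ∩ S = S := inter_eq_right.2 fun x hx => hx.1
  have cG : ContinuousOn (fun x => (Real.exp (φ x / h) * ((φ' x / h) * u x + u' x)) ^ 2)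
      (Icc x₁ x₂) := by fun_prop
  have cE : ContinuousOn (fun x => Real.exp (2 * φ x / h) * (u x) ^ 2) (Icc x₁ x₂) := by
    fun_prop
  have cU : ContinuousOn (fun x => (u x) ^ 2) (Icc x₁ x₂) := by fun_prop
  have iG := cG.integrableOn_Icc (μ := volume)
  have iE := (cE.integrableOn_Icc (μ := volume)).indicator hSm
  have iU := cU.integrableOn_Icc (μ := volume)
  rw [intervalIntegral.integral_of_le hle, ← integral_Icc_eq_integral_Ioc] at hWint ⊢
  rw [intervalIntegral.integral_of_le hle, ← integral_Icc_eq_integral_Ioc]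
  have e1 : ∫ x in S, Real.exp (2 * φ x / h) * (u x) ^ 2
      = ∫ x in Icc x₁ x₂, S.indicator (fun x => Real.exp (2 * φ x / h) * (u x) ^ 2) x := by
    rw [setIntegral_indicator hSm, hSsub]
  have key : ∫ x in Icc x₁ x₂, (h ^ 2 * (Real.exp (φ x / h) * ((φ' x / h) * u x + u' x)) ^ 2
        + ε ^ 2 * S.indicator (fun x => Real.exp (2 * φ x / h) * (u x) ^ 2) x)
      ≤ ∫ x in Icc x₁ x₂, (h ^ 2 * W' x + (κ + ε) * Real.exp (2 * a / h) * (u x) ^ 2) := by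
    refine setIntegral_mono_on ((iG.const_mul _).add (iE.const_mul _))
      ((hIW.const_mul _).add (iU.const_mul _)) measurableSet_Icc fun x hx => ?_
    have hid : h ^ 2 * (Real.exp (φ x / h) * ((φ' x / h) * u x + u' x)) ^ 2
        = h ^ 2 * W' x + Real.exp (2 * φ x / h) * (u x) ^ 2 * (κ - V x + φ' x ^ 2) := by
      have hE : Real.exp (2 * φ x / h) = Real.exp (φ x / h) ^ 2 := by
        rw [← Real.exp_nat_mul]; congr 1; push_cast; ring
      have hq := heq x hx
      simp only [W', hE]
      field_simp
      linear_combination u x * hq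
    have hEu : 0 ≤ Real.exp (2 * φ x / h) * (u x) ^ 2 := by positivity
    rw [hid]
    by_cases hv : κ + ε < V x
    · have hxS : x ∈ S := ⟨hx, hv⟩
      rw [indicator_of_mem hxS]
      have := mul_le_mul_of_nonneg_left (hΩp x hx hv) hEu
      have h3 : 0 ≤ (κ + ε) * Real.exp (2 * a / h) * (u x) ^ 2 := by positivity
      nlinarith
    · have hxS : x ∉ S := fun hc => hv hc.2
      rw [indicator_of_notMem hxS]
      obtain ⟨h1, h2⟩ := hΩm x hx (not_lt.1 hv)
      have h3 := mul_le_mul_of_nonneg_left h2 hEu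
      have h4 : Real.exp (2 * φ x / h) ≤ Real.exp (2 * a / h) := by gcongr
      have h5 : (κ + ε) * Real.exp (2 * φ x / h) * (u x) ^ 2
        ≤ (κ + ε) * Real.exp (2 * a / h) * (u x) ^ 2 := by gcongr
      linarith
  rw [integral_add (iG.const_mul _) (iE.const_mul _),
    integral_add (hIW.const_mul _) (iU.const_mul _), integral_const_mul, integral_const_mul,
    integral_const_mul, integral_const_mul, hWint] at key
  rw [e1]
  linarith
end

section
/- Let x₁ < x₂, let V₀, W : ℝ → ℝ be continuous on [x₁,x₂] with V₀(x) > 0 for all x ∈ [x₁,x₂], and let E, δ, δ', c' be real numbers with 0 < δ < E, 0 < δ' < (x₂−x₁)/4, c' > 0, such that V₀(x) − (E + δ) ≥ c' whenever x ∈ [x₁, x₁+2δ'] ∪ [x₂−2δ', x₂]. Then there exist constants C₁, C₂, h₀ > 0 such that for every h ∈ (0,h₀), every κ ∈ [E−δ, E+δ], and every twice continuously differentiable u : ℝ → ℝ with u(x₁) = u(x₂) = 0 satisfying −h²u''(x) + (V₀(x) + h²W(x))u(x) = κu(x) on [x₁,x₂], one has ∫_{x₁}^{x₁+δ'} (u'(x)²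 + u(x)²) dx + ∫_{x₂−δ'}^{x₂} (u'(x)² + u(x)²) dx ≤ C₁ e^{−C₂/h} ∫_{x₁}^{x₂} u(x)² dx. -/
open Set MeasureTheory

lemma strip_core (a d k : ℝ) (hd : 0 < d) (hk : 1 ≤ k) (u u' u'' : ℝ → ℝ)
    (hu : ∀ x ∈ Icc a (a + 2 * d), HasDerivWithinAt u (u' x) (Icc a (a + 2 * d)) x)
    (hu' : ∀ x ∈ Icc a (a + 2 * d), HasDerivWithinAt u' (u'' x) (Icc a (a + 2 * d)) x)
    (h0 : u a = 0)
    (hq : ∀ x ∈ Icc a (a + 2 * d), k ^ 2 * u x ^ 2 ≤ u x * u'' x) :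
    (∫ x in a..(a + d), ((u' x) ^ 2 + (u x) ^ 2))
      ≤ 8 / d ^ 2 * Real.exp (-(k * d)) * ∫ x in a..(a + 2 * d), (u x) ^ 2 := by
  have cu : ContinuousOn u (Icc a (a + 2 * d)) := fun x hx => (hu x hx).continuousWithinAt
  have cu' : ContinuousOn u' (Icc a (a + 2 * d)) := fun x hx => (hu' x hx).continuousWithinAt
  have dp : ∀ x ∈ Icc a (a + 2 * d), HasDerivWithinAt (fun x => u x * u' x)
      (u' x * u' x + u x * u'' x) (Icc a (a + 2 * d)) x :=
    fun x hx => (hu x hx).mul (hu' x hx)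
  have cp : ContinuousOn (fun x => u x * u' x) (Icc a (a + 2 * d)) := cu.mul cu'
  set F := ∫ x in a..(a + d), ((u' x) ^ 2 + (u x) ^ 2) with hF
  have hF0 : 0 ≤ F := intervalIntegral.integral_nonneg (by linarith) (fun x _ => by positivity)
  have hsub : Icc a (a + d) ⊆ Icc a (a + 2 * d) := Icc_subset_Icc le_rfl (by linarith)
  -- step 1
  have h1 : F ≤ u (a + d) * u' (a + d) := by
    have := intervalIntegral.integral_le_sub_of_hasDeriv_right_of_le
      (g := fun x => u x * u' x) (g' := fun x => u' x * u' x + u x * u'' x)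
      (φ := fun x => (u' x) ^ 2 + (u x) ^ 2) (a := a) (b := a + d) (by linarith)
      (cp.mono hsub) (fun x hx => ?_) ?_ (fun x hx => ?_)
    · simpa [h0] using this
    · have hx' : x ∈ Icc a (a + 2 * d) := hsub (Ioo_subset_Icc_self hx)
      refine HasDerivAt.hasDerivWithinAt ((dp x hx').hasDerivAt (Icc_mem_nhds hx.1 ?_))
      linarith [hx.2]
    · exact (((cu'.pow 2).add (cu.pow 2)).mono hsub).integrableOn_Icc
    · have := hq x (hsub (Ioo_subset_Icc_self hx))
      nlinarith [mul_nonneg (sub_nonneg.2 (one_le_pow₀ hk : 1 ≤ k ^ 2)) (sq_nonneg (u x))]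
  -- step 2
  have h2 : MonotoneOn (fun x => Real.exp (-2 * k * x) * (u x * u' x)) (Icc a (a + 2 * d)) := by
    refine monotoneOn_of_hasDerivWithinAt_nonneg (convex_Icc _ _)
      (f' := fun x => Real.exp (-2 * k * x) * (-2 * k * 1) * (u x * u' x)
        + Real.exp (-2 * k * x) * (u' x * u' x + u x * u'' x)) ?_ ?_ ?_
    · exact (by fun_prop : Continuous fun x => Real.exp (-2 * k * x)).continuousOn.mul cp
    · intro x hx
      have hx' := interior_subset hx
      refine HasDerivWithinAt.mul ?_ ((dp x hx').mono interior_subset)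
      exact (((hasDerivAt_id x).const_mul (-2 * k)).exp).hasDerivWithinAt
    · intro x hx
      have := hq x (interior_subset hx)
      have h3 : 0 ≤ u' x * u' x + u x * u'' x - 2 * k * (u x * u' x) := by
        nlinarith [sq_nonneg (u' x - k * u x)]
      have := mul_nonneg (Real.exp_pos (-2 * k * x)).le h3
      nlinarith
  have h3 : ∀ y ∈ Icc (a + 3 * d / 2) (a + 2 * d), Real.exp (k * d) * F ≤ u y * u' y := by
    intro y hy
    have h4 := h2 (a := a + d) (b := y) ⟨by linarith, by linarith⟩
      ⟨by linarith [hy.1], hy.2⟩ (by linarith [hy.1])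
    simp only at h4
    have h5 : Real.exp (2 * k * y) * (Real.exp (-2 * k * (a + d)) * (u (a + d) * u' (a + d)))
        ≤ u y * u' y := by
      calc _ ≤ Real.exp (2 * k * y) * (Real.exp (-2 * k * y) * (u y * u' y)) := by gcongr
        _ = _ := by rw [← mul_assoc, ← Real.exp_add]; ring_nf; simp
    refine le_trans ?_ h5
    rw [← mul_assoc, ← Real.exp_add]
    gcongr
    nlinarith [hy.1]
  -- step 3
  set A := Real.exp (k * d) * F with hA
  have hA0 : 0 ≤ A := by positivity
  have hsub2 : Icc (a + 3 * d / 2) (a + 2 * d) ⊆ Icc a (a + 2 * d) :=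
    Icc_subset_Icc (by linarith) le_rfl
  have h4 : MonotoneOn (fun x => u x * u x - 2 * A * x) (Icc (a + 3 * d / 2) (a + 2 * d)) := by
    refine monotoneOn_of_hasDerivWithinAt_nonneg (convex_Icc _ _)
      (f' := fun x => (u' x * u x + u x * u' x) - 2 * A * 1) ?_ ?_ ?_
    · exact ((cu.mono hsub2).mul (cu.mono hsub2)).sub (by fun_prop)
    · intro x hx
      have hx' := hsub2 (interior_subset hx)
      have := (hu x hx').mono (interior_subset.trans hsub2)
      exact (this.mul this).sub ((hasDerivAt_id x).const_mul (2 * A)).hasDerivWithinAt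
    · intro x hx
      have := h3 x (interior_subset hx)
      linarith
  have h5 : ∀ y ∈ Icc (a + 7 * d / 4) (a + 2 * d), d / 2 * A ≤ u y ^ 2 := by
    intro y hy
    have := h4 (a := a + 3 * d / 2) (b := y) ⟨by linarith, by linarith⟩
      ⟨by linarith [hy.1], hy.2⟩ (by linarith [hy.1])
    simp only at this
    nlinarith [hy.1, sq_nonneg (u (a + 3 * d / 2)),
      mul_nonneg hA0 (by linarith [hy.1] : 0 ≤ y - (a + 7 * d / 4))]
  have ci : IntervalIntegrable (fun x => u x ^ 2) volume a (a + 2 * d) := by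
    apply ContinuousOn.intervalIntegrable
    rw [uIcc_of_le (by linarith)]
    exact cu.pow 2
  have h6 : ∫ x in (a + 7 * d / 4)..(a + 2 * d), u x ^ 2 ≤ ∫ x in a..(a + 2 * d), u x ^ 2 := by
    apply intervalIntegral.integral_mono_interval (by linarith) (by linarith) le_rfl _ ci
    exact Filter.Eventually.of_forall fun x => sq_nonneg _
  have h7 : d ^ 2 / 8 * A ≤ ∫ x in (a + 7 * d / 4)..(a + 2 * d), u x ^ 2 := by
    have : ∫ x in (a + 7 * d / 4)..(a + 2 * d), d / 2 * A
        ≤ ∫ x in (a + 7 * d / 4)..(a + 2 * d), u x ^ 2 := by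
      apply intervalIntegral.integral_mono_on (by linarith) (by simp) _ h5
      apply ci.mono_set
      rw [uIcc_of_le (by linarith), uIcc_of_le (by linarith)]
      exact Icc_subset_Icc (by linarith) le_rfl
    rw [intervalIntegral.integral_const, smul_eq_mul] at this
    linarith
  have h8 := h7.trans h6
  calc F = 8 / d ^ 2 * Real.exp (-(k * d)) * (d ^ 2 / 8 * A) := by
        rw [hA, Real.exp_neg]
        field_simp
    _ ≤ _ := by gcongr

/-- Exponential suppression in the classically forbidden region (Lemma 4.5 of the paper,
estimate form): Dirichlet eigenfunctions of `−h²(d/dx)² + V₀ + h²W` on `[x₁,x₂]` with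
eigenvalue `κ ∈ [E−δ, E+δ]`, where `V₀ − (E+δ) ≥ c' > 0` on the strips
`[x₁, x₁+2δ'] ∪ [x₂−2δ', x₂]`, are exponentially small (in `1/h`) in the strips of
width `δ'` near the boundary. -/
theorem exponential_suppression_forbidden_region
    (x₁ x₂ : ℝ) (hx : x₁ < x₂)
    (V₀ W : ℝ → ℝ)
    (hV₀cont : ContinuousOn V₀ (Icc x₁ x₂))
    (hWcont : ContinuousOn W (Icc x₁ x₂))
    (hV₀pos : ∀ x ∈ Icc x₁ x₂, 0 < V₀ x)
    (E δ δ' c' : ℝ)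
    (hδ : 0 < δ) (hδE : δ < E)
    (hδ' : 0 < δ') (hδ'lt : δ' < (x₂ - x₁) / 4)
    (hc' : 0 < c')
    (hbarrier : ∀ x, x ∈ Icc x₁ (x₁ + 2 * δ') ∪ Icc (x₂ - 2 * δ') x₂ →
        c' ≤ V₀ x - (E + δ)) :
    ∃ C₁ C₂ h₀ : ℝ, 0 < C₁ ∧ 0 < C₂ ∧ 0 < h₀ ∧
      ∀ h κ : ℝ, 0 < h → h < h₀ → κ ∈ Icc (E - δ) (E + δ) →
        ∀ u u' u'' : ℝ → ℝ,
          (∀ x ∈ Icc x₁ x₂, HasDerivWithinAt u (u' x) (Icc x₁ x₂) x) →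
          (∀ x ∈ Icc x₁ x₂, HasDerivWithinAt u' (u'' x) (Icc x₁ x₂) x) →
          ContinuousOn u'' (Icc x₁ x₂) →
          u x₁ = 0 → u x₂ = 0 →
          (∀ x ∈ Icc x₁ x₂,
            -h ^ 2 * u'' x + (V₀ x + h ^ 2 * W x) * u x = κ * u x) →
          (∫ x in x₁..(x₁ + δ'), ((u' x) ^ 2 + (u x) ^ 2))
            + (∫ x in (x₂ - δ')..x₂, ((u' x) ^ 2 + (u x) ^ 2))
            ≤ C₁ * Real.exp (-C₂ / h) * ∫ x in x₁..x₂, (u x) ^ 2 := by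
  obtain ⟨B, hB⟩ := isCompact_Icc.exists_bound_of_continuousOn hWcont
  have hB0 : 0 ≤ B := (norm_nonneg _).trans (hB x₁ ⟨le_rfl, hx.le⟩)
  set m := Real.sqrt (c' / 2) with hm
  have hm0 : 0 < m := by positivity
  have hm2 : m ^ 2 = c' / 2 := Real.sq_sqrt (by positivity)
  refine ⟨16 / δ' ^ 2, m * δ', min m (m / (B + 1)), by positivity, by positivity,
    by positivity, ?_⟩
  intro h κ hh hh0 hκ u u' u'' hu hu' _ hu1 hu2 heq
  have hhm : h < m := hh0.trans_le (min_le_left _ _)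
  have hhB : h * (B + 1) < m := (lt_div_iff₀ (by positivity)).1 (hh0.trans_le (min_le_right _ _))
  have hk : 1 ≤ m / h := (one_le_div hh).2 hhm.le
  have key : ∀ x ∈ Icc x₁ (x₁ + 2 * δ') ∪ Icc (x₂ - 2 * δ') x₂, x ∈ Icc x₁ x₂ →
      (m / h) ^ 2 * u x ^ 2 ≤ u x * u'' x := by
    intro x hxs hxI
    have e := heq x hxI
    have b := hbarrier x hxs
    have w := hB x hxI
    rw [Real.norm_eq_abs, abs_le] at w
    have hw : -(c' / 2) ≤ h ^ 2 * W x := by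
      have : h ^ 2 * B ≤ m ^ 2 := by nlinarith
      nlinarith [mul_nonneg (sq_nonneg h) (by linarith [w.1] : 0 ≤ W x + B)]
    have e2 : h ^ 2 * (u x * u'' x) = (V₀ x + h ^ 2 * W x - κ) * u x ^ 2 := by
      linear_combination (-(u x)) * e
    have : m ^ 2 * u x ^ 2 ≤ h ^ 2 * (u x * u'' x) := by
      rw [e2, hm2]
      gcongr
      linarith [hκ.2]
    rw [div_pow, div_mul_eq_mul_div, div_le_iff₀ (by positivity)]
    linarith
  have hsL : Icc x₁ (x₁ + 2 * δ') ⊆ Icc x₁ x₂ := Icc_subset_Icc le_rfl (by linarith)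
  have L := strip_core x₁ δ' (m / h) hδ' hk u u' u''
    (fun x hx => (hu x (hsL hx)).mono hsL) (fun x hx => (hu' x (hsL hx)).mono hsL) hu1
    (fun x hx => key x (Or.inl hx) (hsL hx))
  have hmap : MapsTo (fun x : ℝ => x₁ + x₂ - x) (Icc x₁ (x₁ + 2 * δ')) (Icc x₁ x₂) :=
    fun x hx => ⟨by linarith [hx.2], by linarith [hx.1]⟩
  have hrd : ∀ x, HasDerivWithinAt (fun x : ℝ => x₁ + x₂ - x) (-1) (Icc x₁ (x₁ + 2 * δ')) x :=
    fun x => ((hasDerivAt_id x).const_sub (x₁ + x₂)).hasDerivWithinAt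
  have R := strip_core x₁ δ' (m / h) hδ' hk (fun x => u (x₁ + x₂ - x))
    (fun x => - u' (x₁ + x₂ - x)) (fun x => u'' (x₁ + x₂ - x))
    (fun x hx => by
      have := (hu _ (hmap hx)).comp x (hrd x) hmap
      simpa [Function.comp_def] using this)
    (fun x hx => by
      have := ((hu' _ (hmap hx)).comp x (hrd x) hmap).neg
      rw [mul_neg_one, neg_neg] at this
      exact this)
    (by simpa using hu2)
    (fun x hx => key (x₁ + x₂ - x) (Or.inr ⟨by linarith [hx.2], by linarith [hx.1]⟩) (hmap hx))
  rw [intervalIntegral.integral_comp_sub_left (fun x => u x ^ 2) (x₁ + x₂)] at R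
  simp only [neg_sq] at R
  rw [intervalIntegral.integral_comp_sub_left (fun x => u' x ^ 2 + u x ^ 2) (x₁ + x₂)] at R
  rw [show x₁ + x₂ - (x₁ + δ') = x₂ - δ' by ring, show x₁ + x₂ - x₁ = x₂ by ring,
    show x₁ + x₂ - (x₁ + 2 * δ') = x₂ - 2 * δ' by ring] at R
  have ci : IntervalIntegrable (fun x => u x ^ 2) volume x₁ x₂ := by
    apply ContinuousOn.intervalIntegrable
    rw [uIcc_of_le hx.le]
    exact ContinuousOn.pow (fun x hx => (hu x hx).continuousWithinAt) 2
  have iL : ∫ x in x₁..(x₁ + 2 * δ'), u x ^ 2 ≤ ∫ x in x₁..x₂, u x ^ 2 :=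
    intervalIntegral.integral_mono_interval le_rfl (by linarith) (by linarith)
      (Filter.Eventually.of_forall fun x => sq_nonneg _) ci
  have iR : ∫ x in (x₂ - 2 * δ')..x₂, u x ^ 2 ≤ ∫ x in x₁..x₂, u x ^ 2 :=
    intervalIntegral.integral_mono_interval (by linarith) (by linarith) le_rfl
      (Filter.Eventually.of_forall fun x => sq_nonneg _) ci
  have he : -(m / h * δ') = -(m * δ') / h := by ring
  rw [he] at L R
  have hc : 0 ≤ 8 / δ' ^ 2 * Real.exp (-(m * δ') / h) := by positivity
  have L2 := L.trans (mul_le_mul_of_nonneg_left iL hc)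
  have R2 := R.trans (mul_le_mul_of_nonneg_left iR hc)
  calc _ ≤ _ := add_le_add L2 R2
    _ = _ := by ring
end

section
/- Let x₁ < x₂, let V : ℝ → ℝ be continuous on [x₁,x₂], and let E ∈ ℝ and δ > 0 satisfy min_{[x₁,x₂]} V < E − δ. For h > 0 let N(h) denote the set of Dirichlet eigenvalues κ of −h² d²/dx² + V on [x₁,x₂] with κ ∈ [E−δ, E+δ]. Then N(h) is a finite set for every h > 0, and there exist constants c > 0, C > 0 and h₀ > 0 such that for all 0 < h < h₀: (c/h) · ∫_{x₁}^{x₂} √(max(E − V(x), 0)) dx ≤ card N(h) ≤ (C/h) · ∫_{x₁}^{x₂} √(max(E − V(x), 0)) dx. -/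
open Set MeasureTheory

/-- `κ` is a Dirichlet eigenvalue of `−h²(d/dx)² + Q` on `[a,b]`: there is a twice
continuously differentiable `u` on `[a,b]`, not identically zero, with
`−h²u'' + Qu = κu` on `[a,b]` and `u(a) = u(b) = 0`. -/
def IsDirichletEigenvalue (h : ℝ) (Q : ℝ → ℝ) (a b κ : ℝ) : Prop :=
  ∃ u u' u'' : ℝ → ℝ,
    (∀ x ∈ Icc a b, HasDerivWithinAt u (u' x) (Icc a b) x) ∧
    (∀ x ∈ Icc a b, HasDerivWithinAt u' (u'' x) (Icc a b) x) ∧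
    ContinuousOn u'' (Icc a b) ∧
    (∃ x ∈ Icc a b, u x ≠ 0) ∧
    (∀ x ∈ Icc a b, -h ^ 2 * u'' x + Q x * u x = κ * u x) ∧
    u a = 0 ∧ u b = 0

lemma mono_aux {a b : ℝ} {f f' : ℝ → ℝ}
    (hf : ∀ x ∈ Icc a b, HasDerivWithinAt f (f' x) (Icc a b) x)
    (h0 : ∀ x ∈ Icc a b, 0 ≤ f' x) : MonotoneOn f (Icc a b) := by
  apply monotoneOn_of_hasDerivWithinAt_nonneg (f' := f') (convex_Icc a b)
    (fun x hx => (hf x hx).continuousWithinAt)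
  · intro x hx
    exact (hf x (interior_subset hx)).mono interior_subset
  · intro x hx
    exact h0 x (interior_subset hx)

lemma const_aux {a b : ℝ} {f : ℝ → ℝ}
    (hf : ∀ x ∈ Icc a b, HasDerivWithinAt f 0 (Icc a b) x) {x y : ℝ} (hx : x ∈ Icc a b)
    (hy : y ∈ Icc a b) (hxy : x ≤ y) : f x = f y := by
  apply le_antisymm
  · exact mono_aux (f' := fun _ => 0) hf (fun _ _ => le_rfl) hx hy hxy
  · have := mono_aux (f := fun x => - f x) (f' := fun _ => -0) (fun x hx => (hf x hx).neg)
      (fun _ _ => by simp) hx hy hxy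
    simpa using this

lemma prim_aux {a b : ℝ} (hab : a ≤ b) {A : ℝ → ℝ} (hA : ContinuousOn A (Icc a b)) :
    ∃ P : ℝ → ℝ, ∀ x ∈ Icc a b, HasDerivWithinAt P (A x) (Icc a b) x := by
  have hc : Continuous (IccExtend hab ((Icc a b).domRestrict A)) :=
    (continuousOn_iff_continuous_domRestrict.1 hA).Icc_extend'
  refine ⟨fun x => ∫ t in a..x, IccExtend hab ((Icc a b).domRestrict A) t, fun x hx => ?_⟩
  have := (hc.integral_hasStrictDerivAt a x).hasDerivAt.hasDerivWithinAt (s := Icc a b)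
  rwa [IccExtend_of_mem hab _ hx] at this

/-- The Prüfer vector field. -/
noncomputable def prF (h q t : ℝ) : ℝ := (Real.cos t ^ 2 + q * Real.sin t ^ 2) / h

/-- Prüfer angle. -/
def IsPr (h : ℝ) (W : ℝ → ℝ) (a b lam : ℝ) (θ : ℝ → ℝ) : Prop :=
  ∀ x ∈ Icc a b, HasDerivWithinAt θ (prF h (lam - W x) (θ x)) (Icc a b) x

lemma IsPr.cont {h : ℝ} {W : ℝ → ℝ} {a b lam : ℝ} {θ : ℝ → ℝ} (H : IsPr h W a b lam θ) :
    ContinuousOn θ (Icc a b) := fun x hx => (H x hx).continuousWithinAt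

lemma IsPr.mono {h : ℝ} {W : ℝ → ℝ} {a b a' b' lam : ℝ} {θ : ℝ → ℝ} (H : IsPr h W a b lam θ)
    (hs : Icc a' b' ⊆ Icc a b) : IsPr h W a' b' lam θ :=
  fun x hx => (H x (hs hx)).mono hs

lemma prF_eq (h q t : ℝ) : prF h q t = (1 + (q - 1) * Real.sin t ^ 2) / h := by
  unfold prF
  rw [Real.cos_sq']; ring

lemma prF_diff (h q t s : ℝ) :
    prF h q t - prF h q s = (q - 1) / h * (Real.sin (t - s) * Real.sin (t + s)) := by
  rw [prF_eq, prF_eq]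
  have : Real.sin (t - s) * Real.sin (t + s) = Real.sin t ^ 2 - Real.sin s ^ 2 := by
    rw [Real.sin_add, Real.sin_sub]
    have h1 := Real.sin_sq_add_cos_sq t
    have h2 := Real.sin_sq_add_cos_sq s
    linear_combination (Real.sin t ^ 2) * h2 - (Real.sin s ^ 2) * h1
  rw [this]; ring

lemma prF_lip {h : ℝ} (hh : 0 < h) {q M : ℝ} (hq : |q| ≤ M) (t s : ℝ) :
    |prF h q t - prF h q s| ≤ (M + 1) / h * |t - s| := by
  rw [prF_diff, abs_mul, abs_div, abs_of_pos hh, abs_mul]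
  have h1 : |q - 1| ≤ M + 1 := by
    rw [abs_le] at *; constructor <;> linarith
  have h2 : |Real.sin (t - s)| ≤ |t - s| := Real.abs_sin_le_abs
  have h3 := Real.abs_sin_le_one (t + s)
  have h4 : |Real.sin (t - s)| * |Real.sin (t + s)| ≤ |t - s| * 1 := by gcongr
  rw [mul_one] at h4
  have h5 : 0 ≤ M := (abs_nonneg q).trans hq
  gcongr

lemma prF_bound {h : ℝ} (hh : 0 < h) {q M : ℝ} (hq : |q| ≤ M) (t : ℝ) :
    |prF h q t| ≤ (M + 1) / h := by
  rw [prF, abs_div, abs_of_pos hh]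
  gcongr
  have h1 := Real.sin_sq_add_cos_sq t
  have h2 := sq_nonneg (Real.sin t)
  have h3 := sq_nonneg (Real.cos t)
  rw [abs_le] at *
  constructor <;> nlinarith

lemma exists_pr {h : ℝ} (hh : 0 < h) {W : ℝ → ℝ} (hW : Continuous W) {a b : ℝ} (hab : a ≤ b)
    {lam M : ℝ} (hM : ∀ x, |lam - W x| ≤ M) :
    ∃ θ : ℝ → ℝ, θ a = 0 ∧ IsPr h W a b lam θ := by
  have hM0 : 0 ≤ (M + 1) / h := by
    have := (abs_nonneg _).trans (hM 0)
    positivity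
  have hR : 0 ≤ (M + 1) / h * (b - a) := mul_nonneg hM0 (by linarith)
  have hP : IsPicardLindelof (fun x t => prF h (lam - W x) t) (⟨a, left_mem_Icc.2 hab⟩ : Icc a b)
      (0 : ℝ) ⟨_, hR⟩ 0 ⟨_, hM0⟩ ⟨_, hM0⟩ := by
    constructor
    · intro x _
      apply LipschitzOnWith.of_dist_le_mul
      intro t _ s _
      exact prF_lip hh (hM x) t s
    · intro t _
      unfold prF
      fun_prop
    · intro x _ t _
      exact prF_bound hh (hM x) t
    · change (M + 1) / h * max (b - a) (a - a) ≤ (M + 1) / h * (b - a) - 0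
      simp [hab]
  exact hP.exists_eq_forall_mem_Icc_hasDerivWithinAt₀

lemma IsPr.sin_ne {h : ℝ} (hh : 0 < h) {W : ℝ → ℝ} {a b : ℝ} (hab : a < b)
    {lam : ℝ} {θ : ℝ → ℝ} (H : IsPr h W a b lam θ) : ∃ x ∈ Icc a b, Real.sin (θ x) ≠ 0 := by
  by_contra hcon
  push Not at hcon
  have hs : HasDerivWithinAt (fun x => Real.sin (θ x)) 0 (Icc a b) a :=
    (hasDerivWithinAt_const a (Icc a b) (0 : ℝ)).congr hcon (hcon a (left_mem_Icc.2 hab.le))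
  have ha := left_mem_Icc.2 hab.le
  have h2 := (H a ha).sin
  have := (uniqueDiffOn_Icc hab a ha).eq_deriv _ hs h2
  have h3 := hcon a ha
  have h4 := Real.sin_sq_add_cos_sq (θ a)
  rw [h3] at h4
  have h5 : Real.cos (θ a) ≠ 0 := by
    intro h5; rw [h5] at h4; norm_num at h4
  unfold prF at this
  rw [h3] at this
  have h6 : Real.cos (θ a) * ((Real.cos (θ a) ^ 2 + (lam - W a) * 0 ^ 2) / h) ≠ 0 := by
    simp [h5, hh.ne']
  exact h6 this.symm

lemma compare {h : ℝ} (hh : 0 < h) {W : ℝ → ℝ} (hW : Continuous W) {a b : ℝ} (hab : a < b)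
    {lam mu : ℝ} (hl : lam ≤ mu) {θ φ : ℝ → ℝ} (H : IsPr h W a b lam θ) (H' : IsPr h W a b mu φ)
    (h0 : θ a ≤ φ a) : θ b ≤ φ b ∧ (lam < mu → θ b < φ b) := by
  have c1 := H.cont
  have c2 := H'.cont
  have hsc : Continuous Real.sinc := Real.continuous_sinc
  let A : ℝ → ℝ := fun x => ((mu - W x) - 1) / h *
    (Real.sinc (φ x - θ x) * Real.sin (φ x + θ x))
  have hA : ContinuousOn A (Icc a b) := by
    have : ContinuousOn (fun x => Real.sinc (φ x - θ x)) (Icc a b) :=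
      hsc.comp_continuousOn (c2.sub c1)
    have h2 : ContinuousOn (fun x => Real.sin (φ x + θ x)) (Icc a b) :=
      Real.continuous_sin.comp_continuousOn (c2.add c1)
    have h3 : ContinuousOn (fun x => ((mu - W x) - 1) / h) (Icc a b) := by fun_prop
    exact h3.mul (this.mul h2)
  obtain ⟨P, hP⟩ := prim_aux hab.le hA
  let B : ℝ → ℝ := fun x => (mu - lam) / h * Real.sin (θ x) ^ 2
  have key : ∀ x ∈ Icc a b, HasDerivWithinAt (fun x => (φ x - θ x) * Real.exp (-P x))
      (B x * Real.exp (-P x)) (Icc a b) x := by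
    intro x hx
    have := ((H' x hx).sub (H x hx)).mul (hP x hx).neg.exp
    refine this.congr_deriv ?_
    have e1 := prF_diff h (mu - W x) (φ x) (θ x)
    have e2 : prF h (mu - W x) (θ x) - prF h (lam - W x) (θ x) = B x := by
      simp only [prF_eq, B]; ring
    have e3 : Real.sin (φ x - θ x) = (φ x - θ x) * Real.sinc (φ x - θ x) := by
      by_cases hz : φ x - θ x = 0
      · simp [hz]
      · rw [Real.sinc_of_ne_zero hz]; field_simp
    rw [e3] at e1
    simp only [A, Pi.sub_apply, Pi.neg_apply]
    linear_combination Real.exp (-P x) * (e1 + e2)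
  have hB : ∀ x ∈ Icc a b, 0 ≤ B x * Real.exp (-P x) := by
    intro x _
    have : 0 ≤ mu - lam := by linarith
    simp only [B]
    positivity
  have hm := mono_aux key hB
  have ha := left_mem_Icc.2 hab.le
  have hb := right_mem_Icc.2 hab.le
  have hm0 : 0 ≤ (φ a - θ a) * Real.exp (-P a) :=
    mul_nonneg (by linarith) (Real.exp_pos _).le
  have hle : θ b ≤ φ b := by
    have h2 := hm0.trans (hm ha hb hab.le)
    have := nonneg_of_mul_nonneg_left h2 (Real.exp_pos _)
    linarith
  refine ⟨hle, fun hlt => ?_⟩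
  refine lt_of_le_of_ne hle fun heq => ?_
  obtain ⟨y, hy, hne⟩ := H.sin_ne hh hab
  have hz : ∀ x ∈ Icc a b, (φ x - θ x) * Real.exp (-P x) = 0 := by
    intro x hx
    have h1 := hm ha hx hx.1
    have h2 := hm hx hb hx.2
    simp only [heq, sub_self, zero_mul] at h2
    simp only at h1
    linarith
  have hs : HasDerivWithinAt (fun x => (φ x - θ x) * Real.exp (-P x)) 0 (Icc a b) y :=
    (hasDerivWithinAt_const y (Icc a b) (0 : ℝ)).congr hz (hz y hy)
  have := (uniqueDiffOn_Icc hab y hy).eq_deriv _ hs (key y hy)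
  have hpos : 0 < mu - lam := by linarith
  have : 0 < B y * Real.exp (-P y) := by
    simp only [B]; positivity
  linarith

lemma pr_lip {h : ℝ} (hh : 0 < h) {W : ℝ → ℝ} {a b : ℝ} (hab : a ≤ b)
    {M : ℝ} :
    ∃ C : ℝ, 0 ≤ C ∧ ∀ lam mu : ℝ, (∀ x, |lam - W x| ≤ M) → ∀ θ φ : ℝ → ℝ,
      IsPr h W a b lam θ → IsPr h W a b mu φ → θ a = φ a → |θ b - φ b| ≤ C * |lam - mu| := by
  by_cases hM : 0 ≤ M
  swap
  · refine ⟨0, le_rfl, fun lam mu h1 => ?_⟩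
    exact absurd ((abs_nonneg _).trans (h1 0)) hM
  have hM0 : 0 < (M + 1) / h := by positivity
  refine ⟨1 / h / ((M + 1) / h) * (Real.exp ((M + 1) / h * (b - a)) - 1), ?_, ?_⟩
  · have : 1 ≤ Real.exp ((M + 1) / h * (b - a)) :=
      Real.one_le_exp (mul_nonneg hM0.le (by linarith))
    have : 0 ≤ Real.exp ((M + 1) / h * (b - a)) - 1 := by linarith
    positivity
  intro lam mu h1 θ φ H H' h0
  have hd : ∀ {lam : ℝ} {θ : ℝ → ℝ}, IsPr h W a b lam θ → ∀ t ∈ Ico a b,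
      HasDerivWithinAt θ (prF h (lam - W t) (θ t)) (Ici t) t := by
    intro lam θ H t ht
    refine (H t (Ico_subset_Icc_self ht)).mono_of_mem_nhdsWithin ?_
    exact Icc_mem_nhdsGE_of_mem ht
  have := dist_le_of_approx_trajectories_ODE (v := fun x t => prF h (lam - W x) t)
    (K := ⟨_, hM0.le⟩) (f := θ) (g := φ) (a := a) (b := b) (εf := 0) (εg := |lam - mu| / h) (δ := 0)
    (fun x => LipschitzWith.of_dist_le_mul fun t s => prF_lip hh (h1 x) t s)
    H.cont (hd H) (fun t _ => by simp) H'.cont (hd H') ?_ (by simp [h0]) b (right_mem_Icc.2 hab)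
  · rw [gronwallBound_of_K_ne_0 (by exact hM0.ne')] at this
    rw [Real.dist_eq] at this
    refine this.trans (le_of_eq ?_)
    change 0 * Real.exp ((M + 1) / h * (b - a)) + (0 + |lam - mu| / h) / ((M + 1) / h) *
      (Real.exp ((M + 1) / h * (b - a)) - 1) = _
    ring
  · intro t _
    rw [Real.dist_eq]
    have : prF h (mu - W t) (φ t) - prF h (lam - W t) (φ t)
        = (mu - lam) / h * Real.sin (φ t) ^ 2 := by
      simp only [prF_eq]; ring
    rw [this, abs_mul, abs_div, abs_of_pos hh, abs_sub_comm mu lam, abs_of_nonneg (sq_nonneg (Real.sin (φ t)))]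
    have := Real.sin_sq_le_one (φ t)
    exact mul_le_of_le_one_right (by positivity) this

lemma IsPr.exists_rad {h : ℝ} {W : ℝ → ℝ} (hW : Continuous W) {a b : ℝ} (hab : a < b)
    {lam : ℝ} {θ : ℝ → ℝ} (H : IsPr h W a b lam θ) (hh : 0 < h) :
    ∃ R : ℝ → ℝ, (∀ x, 0 < R x) ∧
      (∀ x ∈ Icc a b, HasDerivWithinAt (fun x => R x * Real.sin (θ x))
        (R x * Real.cos (θ x) / h) (Icc a b) x) ∧
      (∀ x ∈ Icc a b, HasDerivWithinAt (fun x => R x * Real.cos (θ x) / h)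
        (-(lam - W x) * (R x * Real.sin (θ x)) / h ^ 2) (Icc a b) x) := by
  have c1 := H.cont
  have hA : ContinuousOn (fun x => (1 - (lam - W x)) / h * (Real.sin (θ x) * Real.cos (θ x)))
      (Icc a b) := by
    have h1 : ContinuousOn (fun x => Real.sin (θ x)) (Icc a b) :=
      Real.continuous_sin.comp_continuousOn c1
    have h2 : ContinuousOn (fun x => Real.cos (θ x)) (Icc a b) :=
      Real.continuous_cos.comp_continuousOn c1
    have h3 : ContinuousOn (fun x => (1 - (lam - W x)) / h) (Icc a b) := by fun_prop
    exact h3.mul (h1.mul h2)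
  obtain ⟨P, hP⟩ := prim_aux hab.le hA
  refine ⟨fun x => Real.exp (P x), fun x => Real.exp_pos _, ?_, ?_⟩
  · intro x hx
    refine ((hP x hx).exp.mul (H x hx).sin).congr_deriv ?_
    have h4 := Real.sin_sq_add_cos_sq (θ x)
    simp only [prF]
    field_simp
    linear_combination Real.cos (θ x) * h4
  · intro x hx
    refine (((hP x hx).exp.mul (H x hx).cos).div_const h).congr_deriv ?_
    have h4 := Real.sin_sq_add_cos_sq (θ x)
    simp only [prF]
    field_simp
    linear_combination - Real.sin (θ x) * (lam - W x) * h4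

lemma eig_iff {h : ℝ} (hh : 0 < h) {W : ℝ → ℝ} (hW : Continuous W) {a b : ℝ} (hab : a < b)
    {lam M : ℝ} (hM : ∀ x, |lam - W x| ≤ M) {θ : ℝ → ℝ} (H : IsPr h W a b lam θ) (h0 : θ a = 0) :
    IsDirichletEigenvalue h W a b lam ↔ Real.sin (θ b) = 0 := by
  obtain ⟨R, hR, d1, d2⟩ := H.exists_rad hW hab hh
  have ha := left_mem_Icc.2 hab.le
  have hb := right_mem_Icc.2 hab.le
  have hM0 : 0 ≤ M := (abs_nonneg _).trans (hM 0)
  constructor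
  · rintro ⟨u, u', u'', hu, hu', -, ⟨y, hy, hne⟩, heq, hua, hub⟩
    have hu2 : ∀ x ∈ Icc a b, u'' x = -(lam - W x) * u x / h ^ 2 := by
      intro x hx
      have := heq x hx
      field_simp
      linarith
    have hw := const_aux (f := fun x => u x * (R x * Real.cos (θ x) / h) -
      u' x * (R x * Real.sin (θ x))) (a := a) (b := b) (fun x hx => by
        refine (((hu x hx).mul (d2 x hx)).sub ((hu' x hx).mul (d1 x hx))).congr_deriv ?_
        rw [hu2 x hx]; ring) ha hb hab.le
    simp only [hua, hub, h0, Real.sin_zero, mul_zero, zero_mul, sub_zero, zero_sub] at hw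
    by_contra hs
    have hu'b : u' b = 0 := by
      have := hR b
      have h5 : u' b * (R b * Real.sin (θ b)) = 0 := by linarith
      rcases mul_eq_zero.1 h5 with h6 | h6
      · exact h6
      · exact absurd h6 (mul_ne_zero this.ne' hs)
    let K := (M + 1) / h
    have hm := mono_aux (a := a) (b := b)
      (f := fun x => (u x ^ 2 + (h * u' x) ^ 2) * Real.exp (K * x))
      (f' := fun x => (2 * u x * u' x * (1 - (lam - W x)) + K * (u x ^ 2 + (h * u' x) ^ 2)) *
        Real.exp (K * x)) (fun x hx => by
          have e1 := (((hu x hx).pow 2).add (((hu' x hx).const_mul h).pow 2)).mul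
            (((hasDerivWithinAt_id x (Icc a b)).const_mul K).exp)
          refine e1.congr_deriv ?_
          simp only [Pi.add_apply, Pi.pow_apply, id]
          rw [hu2 x hx]
          field_simp
          ring) (fun x hx => by
          apply mul_nonneg _ (Real.exp_pos _).le
          have e1 := hM x
          have e2 : |1 - (lam - W x)| ≤ M + 1 := by
            rw [abs_le] at *; constructor <;> linarith
          have e3 : |2 * u x * (h * u' x)| ≤ u x ^ 2 + (h * u' x) ^ 2 := by
            rw [abs_le]; constructor <;> nlinarith [sq_nonneg (u x - h * u' x), sq_nonneg (u x + h * u' x)]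
          have e4 : |(2 * u x * (h * u' x)) * (1 - (lam - W x))| ≤
              (u x ^ 2 + (h * u' x) ^ 2) * (M + 1) := by
            rw [abs_mul]; gcongr
          have e5 := (abs_le.1 e4).1
          have e6 : 2 * u x * u' x * (1 - (lam - W x)) + K * (u x ^ 2 + (h * u' x) ^ 2)
            = ((2 * u x * (h * u' x)) * (1 - (lam - W x)) +
              (u x ^ 2 + (h * u' x) ^ 2) * (M + 1)) / h := by
            simp only [K]; field_simp
          rw [e6]
          apply div_nonneg _ hh.le
          linarith)
    have h7 := hm hy hb hy.2
    simp only [hub, hu'b, mul_zero] at h7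
    have h8 : 0 < (u y ^ 2 + (h * u' y) ^ 2) * Real.exp (K * y) := by positivity
    norm_num at h7
    linarith
  · intro hs
    refine ⟨_, _, _, d1, d2, ?_, ?_, ?_, ?_, ?_⟩
    · have : ContinuousOn (fun x => R x * Real.sin (θ x)) (Icc a b) :=
        fun x hx => (d1 x hx).continuousWithinAt
      have h3 : ContinuousOn (fun x => -(lam - W x)) (Icc a b) := by fun_prop
      exact (h3.mul this).div_const _
    · obtain ⟨y, hy, hne⟩ := H.sin_ne hh hab
      exact ⟨y, hy, mul_ne_zero (hR y).ne' hne⟩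
    · intro x hx
      field_simp
      ring
    · simp [h0]
    · simp [hs]

lemma G_aux {a : ℝ} (ha : 0 < a) : ∃ G : ℝ → ℝ, ∃ B : ℝ,
    (∀ t, HasDerivAt G (1 / (Real.cos t ^ 2 + a * Real.sin t ^ 2)) t) ∧
    ∀ t, |G t - (∫ s in (0 : ℝ)..Real.pi, 1 / (Real.cos s ^ 2 + a * Real.sin s ^ 2)) / Real.pi * t|
      ≤ B := by
  have hpos : ∀ t, 0 < Real.cos t ^ 2 + a * Real.sin t ^ 2 := by
    intro t
    have h4 := Real.sin_sq_add_cos_sq t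
    rcases eq_or_ne (Real.cos t) 0 with h | h
    · rw [h] at h4 ⊢
      have : Real.sin t ^ 2 = 1 := by linarith
      rw [this]; simpa using ha
    · positivity
  let g : ℝ → ℝ := fun t => 1 / (Real.cos t ^ 2 + a * Real.sin t ^ 2)
  have hg : Continuous g := by
    apply Continuous.div continuous_const (by fun_prop)
    exact fun t => (hpos t).ne'
  have hper : Function.Periodic g Real.pi := by
    intro t
    simp [g]
  have hd : ∀ t, HasDerivAt (fun x => ∫ s in (0 : ℝ)..x, g s) (g t) t := fun t =>
    (hg.integral_hasStrictDerivAt 0 t).hasDerivAt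
  set Q := ∫ s in (0 : ℝ)..Real.pi, g s with hQ
  have hc : Continuous (fun x => (∫ s in (0 : ℝ)..x, g s) - Q / Real.pi * x) := by
    have : Continuous (fun x => ∫ s in (0 : ℝ)..x, g s) :=
      continuous_iff_continuousAt.2 fun t => (hd t).continuousAt
    fun_prop
  have hp2 : Function.Periodic (fun x => (∫ s in (0 : ℝ)..x, g s) - Q / Real.pi * x) Real.pi := by
    intro x
    have h1 := hper.intervalIntegral_add_eq x 0
    have h2 := intervalIntegral.integral_add_adjacent_intervals
      (hg.intervalIntegrable 0 x) (hg.intervalIntegrable (μ := volume) x (x + Real.pi))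
    simp only [zero_add] at h1
    simp only
    rw [← h2, h1, ← hQ]
    field_simp
    ring
  obtain ⟨B, hB⟩ := (hp2.isBounded_of_continuous Real.pi_pos.ne' hc).exists_norm_le
  exact ⟨_, B, hd, fun t => hB _ ⟨t, rfl⟩⟩

lemma pos_aux {a : ℝ} (ha : 0 < a) (t : ℝ) : 0 < Real.cos t ^ 2 + a * Real.sin t ^ 2 := by
  have h4 := Real.sin_sq_add_cos_sq t
  rcases eq_or_ne (Real.cos t) 0 with h | h
  · rw [h] at h4 ⊢
    have : Real.sin t ^ 2 = 1 := by linarith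
    rw [this]; simpa using ha
  · positivity

lemma Q_lt {a a' : ℝ} (ha : 0 < a) (haa : a < a') :
    (∫ s in (0 : ℝ)..Real.pi, 1 / (Real.cos s ^ 2 + a' * Real.sin s ^ 2)) <
    ∫ s in (0 : ℝ)..Real.pi, 1 / (Real.cos s ^ 2 + a * Real.sin s ^ 2) := by
  have hc : ∀ {a : ℝ}, 0 < a → Continuous (fun s => 1 / (Real.cos s ^ 2 + a * Real.sin s ^ 2)) := by
    intro a ha
    apply Continuous.div continuous_const (by fun_prop)
    exact fun t => (pos_aux ha t).ne'
  apply intervalIntegral.integral_lt_integral_of_continuousOn_of_le_of_exists_lt Real.pi_pos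
    (hc (ha.trans haa)).continuousOn (hc ha).continuousOn
  · intro x _
    have := pos_aux ha x
    gcongr
  · refine ⟨Real.pi / 2, ⟨by positivity, by linarith [Real.pi_pos]⟩, ?_⟩
    simp
    gcongr

lemma Q_pos {a : ℝ} (ha : 0 < a) :
    0 < ∫ s in (0 : ℝ)..Real.pi, 1 / (Real.cos s ^ 2 + a * Real.sin s ^ 2) := by
  apply intervalIntegral.intervalIntegral_pos_of_pos _ _ Real.pi_pos
  · apply Continuous.intervalIntegrable
    apply Continuous.div continuous_const (by fun_prop)
    exact fun t => (pos_aux ha t).ne'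
  · intro x
    exact one_div_pos.2 (pos_aux ha x)

lemma IsPr.bound {h : ℝ} (hh : 0 < h) {W : ℝ → ℝ} {a b : ℝ} (hab : a ≤ b)
    {lam M : ℝ} (hM : ∀ x, |lam - W x| ≤ M) {θ : ℝ → ℝ} (H : IsPr h W a b lam θ) :
    |θ b - θ a| ≤ (M + 1) / h * (b - a) := by
  have := (convex_Icc a b).norm_image_sub_le_of_norm_hasDerivWithin_le H
    (fun x _ => prF_bound hh (hM x) _) (left_mem_Icc.2 hab) (right_mem_Icc.2 hab)
  rw [Real.norm_eq_abs, Real.norm_eq_abs, abs_of_nonneg (sub_nonneg.2 hab)] at this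
  exact this

/-- growth on an interval where the potential is nearly constant -/
lemma growth {W : ℝ → ℝ} {a b : ℝ} (hab : a < b)
    {lam mu p q : ℝ} (hp : 0 < p) (hpq : p < q) (h1 : ∀ x ∈ Icc a b, lam - W x ≤ p)
    (h2 : ∀ x ∈ Icc a b, q ≤ mu - W x) :
    ∃ α β : ℝ, 0 < α ∧ ∀ h : ℝ, 0 < h → ∀ θ φ : ℝ → ℝ, IsPr h W a b lam θ → IsPr h W a b mu φ →
      α / h - β ≤ (φ b - φ a) - (θ b - θ a) := by
  have hq := hp.trans hpq
  obtain ⟨G, B, hG, hB⟩ := G_aux hp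
  obtain ⟨G', B', hG', hB'⟩ := G_aux hq
  have hlt := Q_lt hp hpq
  have hQ' := Q_pos hq
  set Q := ∫ s in (0 : ℝ)..Real.pi, 1 / (Real.cos s ^ 2 + p * Real.sin s ^ 2)
  set Q' := ∫ s in (0 : ℝ)..Real.pi, 1 / (Real.cos s ^ 2 + q * Real.sin s ^ 2)
  have hQ : 0 < Q := hQ'.trans hlt
  have hpi := Real.pi_pos
  have ha := left_mem_Icc.2 hab.le
  have hb := right_mem_Icc.2 hab.le
  refine ⟨(Real.pi / Q' - Real.pi / Q) * (b - a),
    Real.pi / Q' * (2 * B') + Real.pi / Q * (2 * B), ?_, ?_⟩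
  · apply mul_pos _ (by linarith)
    rw [sub_pos]
    gcongr
  intro h hh θ φ H H'
  have m1 : (b - a) / h ≤ G' (φ b) - G' (φ a) := by
    have := mono_aux (f := fun x => G' (φ x) - x / h) (a := a) (b := b)
      (fun x hx => ((hG' (φ x)).comp_hasDerivWithinAt x (H' x hx)).sub
        ((hasDerivWithinAt_id x _).div_const h)) (fun x hx => by
          have hpos := pos_aux hq (φ x)
          have := h2 x hx
          rw [sub_nonneg, prF, ← mul_div_assoc]
          gcongr
          rw [one_div, inv_mul_eq_div, le_div_iff₀ hpos]
          have : q * Real.sin (φ x) ^ 2 ≤ (mu - W x) * Real.sin (φ x) ^ 2 := by gcongr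
          linarith) ha hb hab.le
    simp only at this
    rw [sub_div]; linarith
  have m2 : G (θ b) - G (θ a) ≤ (b - a) / h := by
    have := mono_aux (f := fun x => x / h - G (θ x)) (a := a) (b := b)
      (fun x hx => ((hasDerivWithinAt_id x _).div_const h).sub
        ((hG (θ x)).comp_hasDerivWithinAt x (H x hx))) (fun x hx => by
          have hpos := pos_aux hp (θ x)
          have := h1 x hx
          rw [sub_nonneg, prF, ← mul_div_assoc]
          gcongr
          rw [one_div, inv_mul_eq_div, div_le_iff₀ hpos]
          have : (lam - W x) * Real.sin (θ x) ^ 2 ≤ p * Real.sin (θ x) ^ 2 := by gcongr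
          linarith) ha hb hab.le
    simp only at this
    rw [sub_div]; linarith
  have n1 := abs_le.1 (hB' (φ b))
  have n2 := abs_le.1 (hB' (φ a))
  have n3 := abs_le.1 (hB (θ b))
  have n4 := abs_le.1 (hB (θ a))
  have r1 : (b - a) / h - 2 * B' ≤ Q' / Real.pi * (φ b - φ a) := by
    rw [mul_sub]; linarith
  have r2 : Q / Real.pi * (θ b - θ a) ≤ (b - a) / h + 2 * B := by
    rw [mul_sub]; linarith
  have r3 : Real.pi / Q' * ((b - a) / h - 2 * B') ≤ φ b - φ a := by
    calc _ ≤ Real.pi / Q' * (Q' / Real.pi * (φ b - φ a)) := by gcongr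
      _ = _ := by field_simp
  have r4 : θ b - θ a ≤ Real.pi / Q * ((b - a) / h + 2 * B) := by
    calc _ = Real.pi / Q * (Q / Real.pi * (θ b - θ a)) := by field_simp
      _ ≤ _ := by gcongr
  have e : (Real.pi / Q' - Real.pi / Q) * (b - a) / h -
      (Real.pi / Q' * (2 * B') + Real.pi / Q * (2 * B)) =
      Real.pi / Q' * ((b - a) / h - 2 * B') - Real.pi / Q * ((b - a) / h + 2 * B) := by ring
  rw [e]
  linarith

lemma count_aux {lo hi : ℝ} (hlh : lo ≤ hi) {T : ℝ → ℝ} (hc : ContinuousOn T (Icc lo hi))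
    (hm : StrictMonoOn T (Icc lo hi)) {S : Set ℝ}
    (hS : S = {κ | κ ∈ Icc lo hi ∧ Real.sin (T κ) = 0}) :
    S.Finite ∧ (T hi - T lo) / Real.pi - 1 ≤ (S.ncard : ℝ) ∧
      (S.ncard : ℝ) ≤ (T hi - T lo) / Real.pi + 1 := by
  have hpi := Real.pi_pos
  have hlo := left_mem_Icc.2 hlh
  have hhi := right_mem_Icc.2 hlh
  set m := ⌈T lo / Real.pi⌉
  set n := ⌊T hi / Real.pi⌋
  have himg : T '' S = (fun k : ℤ => (k : ℝ) * Real.pi) '' (Icc m n) := by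
    ext y
    constructor
    · rintro ⟨κ, hκ, rfl⟩
      rw [hS] at hκ
      obtain ⟨hκ, hs⟩ := hκ
      obtain ⟨k, hk⟩ := Real.sin_eq_zero_iff.1 hs
      refine ⟨k, ⟨?_, ?_⟩, hk⟩
      · apply Int.ceil_le.2
        rw [div_le_iff₀ hpi, hk]
        exact hm.monotoneOn hlo hκ hκ.1
      · apply Int.le_floor.2
        rw [le_div_iff₀ hpi, hk]
        exact hm.monotoneOn hκ hhi hκ.2
    · rintro ⟨k, ⟨h1, h2⟩, rfl⟩
      have h1 := Int.ceil_le.1 h1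
      have h2 := Int.le_floor.1 h2
      rw [div_le_iff₀ hpi] at h1
      rw [le_div_iff₀ hpi] at h2
      obtain ⟨κ, hκ, he⟩ := intermediate_value_Icc hlh hc ⟨h1, h2⟩
      refine ⟨κ, ?_, he⟩
      rw [hS]
      refine ⟨hκ, ?_⟩
      rw [he]
      exact Real.sin_int_mul_pi k
  have hinj : InjOn T S := hm.injOn.mono (by rw [hS]; exact fun κ h => h.1)
  have hfin : (Icc m n).Finite := finite_Icc m n
  have hcard : S.ncard = (n + 1 - m).toNat := by
    rw [← hinj.ncard_image, himg, ncard_image_of_injective]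
    · rw [← Finset.coe_Icc, ncard_coe_finset, Int.card_Icc]
    · intro k l hkl
      have := mul_right_cancel₀ hpi.ne' hkl
      exact_mod_cast this
  have hT : T lo / Real.pi ≤ T hi / Real.pi := by
    have := hm.monotoneOn hlo hhi hlh
    gcongr
  have hmn : 0 ≤ n + 1 - m := by
    have h1 : m ≤ n + 1 := by
      apply Int.ceil_le.2
      have := Int.lt_floor_add_one (T hi / Real.pi)
      push_cast
      exact (hT.trans_lt this).le
    linarith
  refine ⟨Finite.of_finite_image (himg ▸ hfin.image _) hinj, ?_⟩
  have hcr : (S.ncard : ℝ) = n + 1 - m := by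
    rw [hcard]
    have : (((n + 1 - m).toNat : ℤ) : ℝ) = ((n + 1 - m : ℤ) : ℝ) := by
      rw [Int.toNat_of_nonneg hmn]
    push_cast at this
    exact_mod_cast this
  rw [hcr, sub_div]
  have a1 := Int.lt_floor_add_one (T hi / Real.pi)
  have a2 := Int.floor_le (T hi / Real.pi)
  have a3 := Int.ceil_lt_add_one (T lo / Real.pi)
  have a4 := Int.le_ceil (T lo / Real.pi)
  constructor <;> linarith

lemma IsPr.shift {h : ℝ} {W : ℝ → ℝ} {a b lam : ℝ} {θ : ℝ → ℝ} (H : IsPr h W a b lam θ) (k : ℤ) :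
    IsPr h W a b lam (fun x => θ x + k * Real.pi) := by
  intro x hx
  refine ((H x hx).add_const _).congr_deriv ?_
  rw [prF_eq, prF_eq]
  rw [Real.sin_add_int_mul_pi]
  have : ((-1 : ℝ) ^ k * Real.sin (θ x)) ^ 2 = Real.sin (θ x) ^ 2 := by
    rw [mul_pow, ← zpow_natCast, ← zpow_mul, mul_comm k, zpow_mul]; simp
  rw [this]

lemma weyl_core {a b : ℝ} (hab : a < b) {W : ℝ → ℝ} (hW : Continuous W) {M₀ : ℝ}
    (hM₀ : ∀ x, |W x| ≤ M₀) {E δ : ℝ} (hδ : 0 < δ) (hmin : ∃ x ∈ Icc a b, W x < E - δ) :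
    (∀ h : ℝ, 0 < h →
      {κ : ℝ | κ ∈ Icc (E - δ) (E + δ) ∧ IsDirichletEigenvalue h W a b κ}.Finite) ∧
    ∃ c C h₀ : ℝ, 0 < c ∧ 0 < C ∧ 0 < h₀ ∧
      ∀ h : ℝ, 0 < h → h < h₀ →
        c / h ≤ ({κ : ℝ | κ ∈ Icc (E - δ) (E + δ) ∧ IsDirichletEigenvalue h W a b κ}.ncard : ℝ) ∧
        ({κ : ℝ | κ ∈ Icc (E - δ) (E + δ) ∧ IsDirichletEigenvalue h W a b κ}.ncard : ℝ)
          ≤ C / h := by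
  have hpi := Real.pi_pos
  have hM₀0 : 0 ≤ M₀ := (abs_nonneg _).trans (hM₀ 0)
  set M := M₀ + |E| + δ with hMdef
  have hM0 : 0 ≤ M := by positivity
  have hM : ∀ lam ∈ Icc (E - δ) (E + δ), ∀ x, |lam - W x| ≤ M := by
    intro lam hl x
    have h1 := abs_le.1 (hM₀ x)
    have h2 := le_abs_self E
    have h3 := neg_abs_le E
    rw [abs_le]
    constructor <;> linarith [hl.1, hl.2]
  have hlh : E - δ ≤ E + δ := by linarith
  have hlo := left_mem_Icc.2 hlh
  have hhi := right_mem_Icc.2 hlh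
  -- the subinterval
  obtain ⟨x₀, hx₀, hWx⟩ := hmin
  obtain ⟨r, hr, hball⟩ := Metric.continuous_iff.1 hW x₀ (δ / 2) (by positivity)
  let a' := max a (x₀ - r / 2)
  let b' := min b (x₀ + r / 2)
  have hab' : a' < b' := by
    apply max_lt <;> apply lt_min <;> linarith [hx₀.1, hx₀.2]
  have haa' : a ≤ a' := le_max_left _ _
  have hbb' : b' ≤ b := min_le_left _ _
  have hnear : ∀ x ∈ Icc a' b', |W x - W x₀| < δ / 2 := by
    intro x hx
    apply hball
    rw [Real.dist_eq, abs_lt]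
    have := (le_max_right a (x₀ - r / 2)).trans hx.1
    have := hx.2.trans (min_le_right b (x₀ + r / 2))
    constructor <;> linarith
  obtain ⟨α, β, hα, hgrow⟩ := growth (W := W) hab' (lam := E - δ) (mu := E + δ)
    (p := E - δ - W x₀ + δ / 2) (q := E + δ - W x₀ - δ / 2) (by linarith) (by linarith)
    (fun x hx => by have := (abs_lt.1 (hnear x hx)); linarith)
    (fun x hx => by have := (abs_lt.1 (hnear x hx)); linarith)
  -- main count, for each h
  have main : ∀ h : ℝ, 0 < h →
      {κ : ℝ | κ ∈ Icc (E - δ) (E + δ) ∧ IsDirichletEigenvalue h W a b κ}.Finite ∧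
      (α / h - β - Real.pi) / Real.pi - 1 ≤
        ({κ : ℝ | κ ∈ Icc (E - δ) (E + δ) ∧ IsDirichletEigenvalue h W a b κ}.ncard : ℝ) ∧
      ({κ : ℝ | κ ∈ Icc (E - δ) (E + δ) ∧ IsDirichletEigenvalue h W a b κ}.ncard : ℝ) ≤
        (2 * ((M + 1) / h * (b - a))) / Real.pi + 1 := by
    intro h hh
    have hex : ∀ lam : ℝ, ∃ θ : ℝ → ℝ, lam ∈ Icc (E - δ) (E + δ) →
        (θ a = 0 ∧ IsPr h W a b lam θ) := by
      intro lam
      by_cases hl : lam ∈ Icc (E - δ) (E + δ)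
      · obtain ⟨θ, h1⟩ := exists_pr hh hW hab.le (hM lam hl)
        exact ⟨θ, fun _ => h1⟩
      · exact ⟨fun _ => 0, fun h => absurd h hl⟩
    choose θ hθ using hex
    let T : ℝ → ℝ := fun lam => θ lam b
    have hmono : StrictMonoOn T (Icc (E - δ) (E + δ)) := by
      intro lam hl mu hm hlt
      exact (compare hh hW hab hlt.le (hθ lam hl).2 (hθ mu hm).2
        (by rw [(hθ lam hl).1, (hθ mu hm).1])).2 hlt
    have hcont : ContinuousOn T (Icc (E - δ) (E + δ)) := by
      obtain ⟨C, hC, hL⟩ := pr_lip hh (W := W) hab.le (M := M)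
      have : LipschitzOnWith ⟨C, hC⟩ T (Icc (E - δ) (E + δ)) := by
        apply LipschitzOnWith.of_dist_le_mul
        intro lam hl mu hm
        exact hL lam mu (hM lam hl) _ _ (hθ lam hl).2 (hθ mu hm).2
          (by rw [(hθ lam hl).1, (hθ mu hm).1])
      exact this.continuousOn
    obtain ⟨hfin, hlow, hup⟩ := count_aux hlh hcont hmono
      (S := {κ : ℝ | κ ∈ Icc (E - δ) (E + δ) ∧ IsDirichletEigenvalue h W a b κ}) (by
        ext κ
        simp only [mem_ofPred_eq]
        refine and_congr_right fun hκ => ?_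
        exact eig_iff hh hW hab (hM κ hκ) (hθ κ hκ).2 (hθ κ hκ).1)
    refine ⟨hfin, ?_, ?_⟩
    · refine le_trans ?_ hlow
      refine sub_le_sub_right (div_le_div_of_nonneg_right ?_ hpi.le) 1
      -- growth
      have P1 := (hθ _ hlo).2
      have P2 := (hθ _ hhi).2
      have s1 : θ (E - δ) a' ≤ θ (E + δ) a' := by
        rcases haa'.eq_or_lt with h1 | h1
        · rw [← h1, (hθ _ hlo).1, (hθ _ hhi).1]
        · have hs : Icc a a' ⊆ Icc a b := Icc_subset_Icc le_rfl (hab'.le.trans hbb')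
          exact (compare hh hW h1 hlh (P1.mono hs) (P2.mono hs)
            (by rw [(hθ _ hlo).1, (hθ _ hhi).1])).1
      have hs : Icc a' b' ⊆ Icc a b := Icc_subset_Icc haa' hbb'
      have s2 := hgrow h hh _ _ (P1.mono hs) (P2.mono hs)
      set k := ⌊(θ (E + δ) b' - θ (E - δ) b') / Real.pi⌋ with hk
      have k1 : (k : ℝ) * Real.pi ≤ θ (E + δ) b' - θ (E - δ) b' := by
        rw [← le_div_iff₀ hpi]; exact Int.floor_le _
      have k2 : θ (E + δ) b' - θ (E - δ) b' < ((k : ℝ) + 1) * Real.pi := by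
        rw [← div_lt_iff₀ hpi]; exact Int.lt_floor_add_one _
      have s3 : θ (E - δ) b + k * Real.pi ≤ θ (E + δ) b := by
        rcases hbb'.eq_or_lt with h1 | h1
        · rw [← h1]; linarith
        · have hs : Icc b' b ⊆ Icc a b := Icc_subset_Icc (haa'.trans hab'.le) le_rfl
          exact (compare hh hW h1 hlh ((P1.mono hs).shift k) (P2.mono hs) (by linarith)).1
      simp only [T]
      linarith
    · refine hup.trans ?_
      gcongr
      have b1 := (hθ _ hlo).2.bound hh hab.le (hM _ hlo)
      have b2 := (hθ _ hhi).2.bound hh hab.le (hM _ hhi)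
      rw [(hθ _ hlo).1, sub_zero] at b1
      rw [(hθ _ hhi).1, sub_zero] at b2
      have b1 := (abs_le.1 b1).1
      have b2 := (abs_le.1 b2).2
      simp only [T]
      linarith
  refine ⟨fun h hh => (main h hh).1, α / (2 * Real.pi), 2 * (M + 1) * (b - a) / Real.pi + 1,
    min 1 (α / (2 * (|β| + 2 * Real.pi))), by positivity, ?_, by positivity, ?_⟩
  · have : 0 < b - a := by linarith
    positivity
  intro h hh hlt
  obtain ⟨-, hlow, hup⟩ := main h hh
  have hl1 : h < 1 := hlt.trans_le (min_le_left _ _)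
  have hl2 : h < α / (2 * (|β| + 2 * Real.pi)) := hlt.trans_le (min_le_right _ _)
  constructor
  · refine le_trans ?_ hlow
    rw [lt_div_iff₀ (by positivity)] at hl2
    have e : (α / h - β - Real.pi) / Real.pi - 1 - α / (2 * Real.pi) / h =
        (α - h * (2 * (β + 2 * Real.pi))) / (2 * Real.pi * h) := by
      field_simp; ring
    have : 0 ≤ (α - h * (2 * (β + 2 * Real.pi))) / (2 * Real.pi * h) := by
      apply div_nonneg _ (by positivity)
      have := mul_le_mul_of_nonneg_left (le_abs_self β) hh.le
      nlinarith
    linarith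
  · refine hup.trans ?_
    have : 1 ≤ 1 / h := by rw [le_div_iff₀ hh]; linarith
    calc _ ≤ (2 * ((M + 1) / h * (b - a))) / Real.pi + 1 / h := by gcongr
      _ = _ := by field_simp

lemma eig_congr {h : ℝ} {V W : ℝ → ℝ} {a b κ : ℝ} (hVW : ∀ x ∈ Icc a b, V x = W x) :
    IsDirichletEigenvalue h V a b κ ↔ IsDirichletEigenvalue h W a b κ := by
  constructor
  · rintro ⟨u, u', u'', h1, h2, h3, h4, h5, h6⟩
    exact ⟨u, u', u'', h1, h2, h3, h4, fun x hx => by rw [← hVW x hx]; exact h5 x hx, h6⟩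
  · rintro ⟨u, u', u'', h1, h2, h3, h4, h5, h6⟩
    exact ⟨u, u', u'', h1, h2, h3, h4, fun x hx => by rw [hVW x hx]; exact h5 x hx, h6⟩

/-- Weyl's law (Lemma 4.2 of the paper): the number of Dirichlet eigenvalues of
`−h²(d/dx)² + V` on `[x₁,x₂]` lying in the window `[E−δ, E+δ]` is finite and, for
small `h`, comparable to `h⁻¹ ∫ √(max(E−V,0))`. -/
theorem weyl_law
    (x₁ x₂ : ℝ) (hx : x₁ < x₂)
    (V : ℝ → ℝ) (hV : ContinuousOn V (Icc x₁ x₂))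
    (E δ : ℝ) (hδ : 0 < δ)
    (hmin : ∃ x ∈ Icc x₁ x₂, V x < E - δ) :
    (∀ h : ℝ, 0 < h →
      {κ : ℝ | κ ∈ Icc (E - δ) (E + δ) ∧ IsDirichletEigenvalue h V x₁ x₂ κ}.Finite) ∧
    ∃ c C h₀ : ℝ, 0 < c ∧ 0 < C ∧ 0 < h₀ ∧
      ∀ h : ℝ, 0 < h → h < h₀ →
        (c / h) * (∫ x in x₁..x₂, Real.sqrt (max (E - V x) 0))
            ≤ ({κ : ℝ | κ ∈ Icc (E - δ) (E + δ) ∧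
                IsDirichletEigenvalue h V x₁ x₂ κ}.ncard : ℝ) ∧
        ({κ : ℝ | κ ∈ Icc (E - δ) (E + δ) ∧
                IsDirichletEigenvalue h V x₁ x₂ κ}.ncard : ℝ)
            ≤ (C / h) * (∫ x in x₁..x₂, Real.sqrt (max (E - V x) 0)) := by
  let W : ℝ → ℝ := IccExtend hx.le ((Icc x₁ x₂).domRestrict V)
  have hW : Continuous W := (continuousOn_iff_continuous_domRestrict.1 hV).Icc_extend'
  have hVW : ∀ x ∈ Icc x₁ x₂, V x = W x := fun x h => (IccExtend_of_mem hx.le ((Icc x₁ x₂).domRestrict V) h).symm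
  obtain ⟨M₀, hM⟩ := isCompact_Icc.exists_bound_of_continuousOn hV
  have hM₀ : ∀ x, |W x| ≤ M₀ := fun x => hM _ (projIcc x₁ x₂ hx.le x).2
  obtain ⟨x₀, hx₀, hlt⟩ := hmin
  obtain ⟨hfin, c, C, h₀, hc, hC, hh₀, hb⟩ := weyl_core hx hW hM₀ hδ ⟨x₀, hx₀, hVW x₀ hx₀ ▸ hlt⟩
  have hI : 0 < ∫ x in x₁..x₂, Real.sqrt (max (E - V x) 0) := by
    apply intervalIntegral.integral_pos hx
    · exact Real.continuous_sqrt.comp_continuousOn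
        (ContinuousOn.sup (continuousOn_const.sub hV) continuousOn_const)
    · exact fun x _ => Real.sqrt_nonneg _
    · refine ⟨x₀, hx₀, Real.sqrt_pos.2 (lt_max_of_lt_left ?_)⟩
      linarith
  simp only [eig_congr hVW]
  refine ⟨hfin, c / (∫ x in x₁..x₂, Real.sqrt (max (E - V x) 0)),
    C / (∫ x in x₁..x₂, Real.sqrt (max (E - V x) 0)), h₀, by positivity, by positivity, hh₀, ?_⟩
  intro h hh hlt
  obtain ⟨h1, h2⟩ := hb h hh hlt
  set I := ∫ x in x₁..x₂, Real.sqrt (max (E - V x) 0)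
  have e : ∀ d : ℝ, d / I / h * I = d / h := fun d => by field_simp
  rw [e, e]
  exact ⟨h1, h2⟩
end

section
/- Let h > 0, E ∈ ℝ, let x₀ < x₁ < … < x_k be real numbers, and let V : ℝ → ℝ be continuous on [x₀, x_k]. For 1 ≤ i ≤ k let V⁺ᵢ := max of V on [x_{i−1}, x_i] and V⁻ᵢ := min of V on [x_{i−1}, x_i]. Then the set of Dirichlet eigenvalues κ ≤ E of −h² d²/dx² + V on [x₀, x_k] is finite, and its cardinality D satisfies Σ_{i=1}^{k} D⁺ᵢ ≤ D ≤ Σ_{i=1}^{k} N⁻ᵢ, where D⁺ᵢ is the (finite) number of Dirichlet eigenvalues κ ≤ E of −h² d²/dx² + V⁺ᵢ on [x_{i−1}, x_i], and N⁻ᵢ is the (finite) number of Neumann eigenvalues κ ≤ E of −h² d²/dx² + V⁻ᵢ on [x_{i−1}, x_i]. -/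
open Set MeasureTheory

/-- `κ` is a Neumann eigenvalue of `−h²(d/dx)² + Q` on `[a,b]`. -/
def IsNeumannEigenvalue (h : ℝ) (Q : ℝ → ℝ) (a b κ : ℝ) : Prop :=
  ∃ u u' u'' : ℝ → ℝ,
    (∀ x ∈ Icc a b, HasDerivWithinAt u (u' x) (Icc a b) x) ∧
    (∀ x ∈ Icc a b, HasDerivWithinAt u' (u'' x) (Icc a b) x) ∧
    ContinuousOn u'' (Icc a b) ∧
    (∃ x ∈ Icc a b, u x ≠ 0) ∧
    (∀ x ∈ Icc a b, -h ^ 2 * u'' x + Q x * u x = κ * u x) ∧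
    u' a = 0 ∧ u' b = 0

/-- Integrating factor: a primitive on `[a,b]` of a function continuous on `[a,b]`. -/
lemma exists_primitive_Icc {a b : ℝ} (hab : a < b) {c : ℝ → ℝ} (hc : ContinuousOn c (Icc a b)) :
    ∃ C : ℝ → ℝ, ∀ t ∈ Icc a b, HasDerivWithinAt C (c t) (Icc a b) t := by
  have h1 : Continuous (IccExtend hab.le ((Icc a b).domRestrict c)) :=
    (continuousOn_iff_continuous_domRestrict.mp hc).Icc_extend'
  refine ⟨fun t => ∫ s in a..t, IccExtend hab.le ((Icc a b).domRestrict c) s, fun t ht => ?_⟩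
  have h2 := (h1.integral_hasStrictDerivAt a t).hasDerivAt.hasDerivWithinAt (s := Icc a b)
  have h3 : IccExtend hab.le ((Icc a b).domRestrict c) t = c t := by
    rw [IccExtend_of_mem hab.le _ ht]; rfl
  rwa [h3] at h2

lemma mono_of_deriv_Icc {a b : ℝ} {f f' : ℝ → ℝ}
    (hf : ∀ t ∈ Icc a b, HasDerivWithinAt f (f' t) (Icc a b) t)
    (h0 : ∀ t ∈ Icc a b, 0 ≤ f' t) : MonotoneOn f (Icc a b) := by
  apply monotoneOn_of_hasDerivWithinAt_nonneg (convex_Icc a b) (f' := f')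
    (fun t ht => (hf t ht).continuousWithinAt)
  · exact fun t ht => (hf t (interior_subset ht)).mono interior_subset
  · exact fun t ht => h0 t (interior_subset ht)

/-- Linear differential inequality `y' ≥ c y`. -/
lemma linear_ineq {a b : ℝ} (hab : a < b) {c y y' : ℝ → ℝ} (hc : ContinuousOn c (Icc a b))
    (hy : ∀ t ∈ Icc a b, HasDerivWithinAt y (y' t) (Icc a b) t)
    (hle : ∀ t ∈ Icc a b, c t * y t ≤ y' t) (ha : 0 ≤ y a) :
    (∀ t ∈ Icc a b, 0 ≤ y t) ∧ (y b = 0 → ∀ t ∈ Icc a b, y t = 0) := by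
  obtain ⟨C, hC⟩ := exists_primitive_Icc hab hc
  have hd : ∀ t ∈ Icc a b, HasDerivWithinAt (fun t => Real.exp (-C t) * y t)
      (Real.exp (-C t) * (-c t) * y t + Real.exp (-C t) * y' t) (Icc a b) t :=
    fun t ht => ((hC t ht).neg.exp).mul (hy t ht)
  have hm := mono_of_deriv_Icc hd (fun t ht => by
    have := mul_nonneg (Real.exp_pos (-C t)).le (sub_nonneg.mpr (hle t ht))
    linarith)
  have hA : a ∈ Icc a b := ⟨le_rfl, hab.le⟩
  have hB : b ∈ Icc a b := ⟨hab.le, le_rfl⟩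
  have h1 : ∀ t ∈ Icc a b, 0 ≤ y t := fun t ht => by
    have h2 := hm hA ht ht.1
    have h3 : 0 ≤ Real.exp (-C a) * y a := mul_nonneg (Real.exp_pos _).le ha
    exact nonneg_of_mul_nonneg_right (h3.trans h2) (Real.exp_pos _)
  refine ⟨h1, fun hb t ht => ?_⟩
  have h2 := hm ht hB ht.2
  simp only [hb, mul_zero] at h2
  have h3 := nonpos_of_mul_nonpos_right h2 (Real.exp_pos _)
  exact le_antisymm h3 (h1 t ht)

/-- Linear homogeneous equation `y' = c y`: a solution vanishing somewhere vanishes everywhere. -/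
lemma linear_zero {a b : ℝ} (hab : a < b) {c y : ℝ → ℝ} (hc : ContinuousOn c (Icc a b))
    (hy : ∀ t ∈ Icc a b, HasDerivWithinAt y (c t * y t) (Icc a b) t)
    {s : ℝ} (hs : s ∈ Icc a b) (hz : y s = 0) : ∀ t ∈ Icc a b, y t = 0 := by
  obtain ⟨C, hC⟩ := exists_primitive_Icc hab hc
  have hd : ∀ t ∈ Icc a b, HasDerivWithinAt (fun t => Real.exp (-C t) * y t) 0 (Icc a b) t :=
    fun t ht => by
      have := ((hC t ht).neg.exp).mul (hy t ht)
      refine this.congr_deriv ?_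
      ring
  have hk := constant_of_derivWithin_zero (fun t ht => (hd t ht).differentiableWithinAt)
    (fun t ht => (hd t (Ico_subset_Icc_self ht)).derivWithin
      (uniqueDiffOn_Icc hab t (Ico_subset_Icc_self ht)))
  intro t ht
  have h1 := hk t ht
  have h2 := hk s hs
  simp only [hz, mul_zero] at h2
  rw [← h2] at h1
  exact (mul_eq_zero.mp h1).resolve_left (Real.exp_pos _).ne'

/-- The Prüfer vector field. -/
noncomputable def pruferF (q θ : ℝ) : ℝ := Real.cos θ ^ 2 + q * Real.sin θ ^ 2

lemma pruferF_sub (q θ₁ θ₂ : ℝ) :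
    pruferF q θ₂ - pruferF q θ₁
      = ((q - 1) * (Real.sinc (θ₂ - θ₁) * Real.sin (θ₁ + θ₂))) * (θ₂ - θ₁) := by
  have h1 : Real.sinc (θ₂ - θ₁) * (θ₂ - θ₁) = Real.sin (θ₂ - θ₁) := by
    by_cases h : θ₂ - θ₁ = 0
    · simp [h]
    · rw [Real.sinc_of_ne_zero h]; exact div_mul_cancel₀ _ h
  have h2 : Real.sin (θ₂ - θ₁) * Real.sin (θ₁ + θ₂) = Real.sin θ₂ ^ 2 - Real.sin θ₁ ^ 2 := by
    rw [Real.sin_sub, Real.sin_add]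
    have e1 := Real.sin_sq_add_cos_sq θ₁
    have e2 := Real.sin_sq_add_cos_sq θ₂
    have f1 : Real.cos θ₁ ^ 2 = 1 - Real.sin θ₁ ^ 2 := by linarith
    have f2 : Real.cos θ₂ ^ 2 = 1 - Real.sin θ₂ ^ 2 := by linarith
    linear_combination (Real.sin θ₂ ^ 2) * f1 - (Real.sin θ₁ ^ 2) * f2
  unfold pruferF
  rw [Real.cos_sq' θ₁, Real.cos_sq' θ₂]
  calc _ = (q - 1) * (Real.sin θ₂ ^ 2 - Real.sin θ₁ ^ 2) := by ring
    _ = _ := by rw [← h2, ← h1]; ring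

lemma pruferF_lip (q θ₁ θ₂ : ℝ) :
    |pruferF q θ₂ - pruferF q θ₁| ≤ (|q| + 1) * |θ₂ - θ₁| := by
  rw [pruferF_sub, abs_mul]
  apply mul_le_mul_of_nonneg_right _ (abs_nonneg _)
  rw [abs_mul, abs_mul]
  have h1 : |q - 1| ≤ |q| + 1 := by simpa using abs_sub q 1
  have h2 := mul_le_one₀ (Real.abs_sinc_le_one (θ₂ - θ₁)) (abs_nonneg _)
    (Real.abs_sin_le_one (θ₁ + θ₂))
  calc _ ≤ (|q| + 1) * 1 := mul_le_mul h1 h2 (by positivity) (by positivity)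
    _ = _ := by ring

lemma pruferF_bound (q θ : ℝ) : |pruferF q θ| ≤ |q| + 1 := by
  unfold pruferF
  have h1 := Real.cos_sq_le_one θ
  have h2 := Real.sin_sq_le_one θ
  calc _ ≤ |Real.cos θ ^ 2| + |q * Real.sin θ ^ 2| := abs_add_le _ _
    _ ≤ 1 + |q| * 1 := by
      rw [abs_mul, abs_of_nonneg (sq_nonneg (Real.cos θ)), abs_of_nonneg (sq_nonneg (Real.sin θ))]
      gcongr
    _ = _ := by ring

/-- Comparison theorem for Prüfer angles. -/
lemma prufer_compare {a b : ℝ} (hab : a < b) {q θ₁ θ₂ p₁ p₂ : ℝ → ℝ}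
    (hq : ContinuousOn q (Icc a b))
    (h₁ : ∀ t ∈ Icc a b, HasDerivWithinAt θ₁ (p₁ t) (Icc a b) t)
    (h₂ : ∀ t ∈ Icc a b, HasDerivWithinAt θ₂ (p₂ t) (Icc a b) t)
    (hl : ∀ t ∈ Icc a b, p₁ t ≤ pruferF (q t) (θ₁ t))
    (hu : ∀ t ∈ Icc a b, pruferF (q t) (θ₂ t) ≤ p₂ t)
    (ha : θ₁ a ≤ θ₂ a) :
    θ₁ b ≤ θ₂ b ∧
      (θ₁ b = θ₂ b → ∀ t ∈ Icc a b, θ₁ t = θ₂ t ∧ p₁ t = p₂ t) := by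
  have c1 : ContinuousOn θ₁ (Icc a b) := fun t ht => (h₁ t ht).continuousWithinAt
  have c2 : ContinuousOn θ₂ (Icc a b) := fun t ht => (h₂ t ht).continuousWithinAt
  have hc : ContinuousOn (fun t => (q t - 1) *
      (Real.sinc (θ₂ t - θ₁ t) * Real.sin (θ₁ t + θ₂ t))) (Icc a b) := by
    apply (hq.sub continuousOn_const).mul
    exact (Real.continuous_sinc.comp_continuousOn (c2.sub c1)).mul
      (Real.continuous_sin.comp_continuousOn (c1.add c2))
  have key := linear_ineq hab hc (y := fun t => θ₂ t - θ₁ t) (y' := fun t => p₂ t - p₁ t)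
    (fun t ht => (h₂ t ht).sub (h₁ t ht))
    (fun t ht => by
      have := pruferF_sub (q t) (θ₁ t) (θ₂ t)
      have e1 := hl t ht
      have e2 := hu t ht
      rw [← this]; linarith) (sub_nonneg.mpr ha)
  refine ⟨sub_nonneg.mp (key.1 b ⟨hab.le, le_rfl⟩), fun hb => ?_⟩
  have heq : ∀ t ∈ Icc a b, θ₁ t = θ₂ t := fun t ht =>
    (sub_eq_zero.mp (key.2 (sub_eq_zero.mpr hb.symm) t ht)).symm
  refine fun t ht => ⟨heq t ht, ?_⟩
  exact (uniqueDiffOn_Icc hab t ht).eq_deriv _ ((h₁ t ht)) ((h₂ t ht).congr heq (heq t ht))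

/-- `θ` solves the Prüfer equation with coefficient `q` on `[a,b]`. -/
def IsPrufer (q : ℝ → ℝ) (a b : ℝ) (θ : ℝ → ℝ) : Prop :=
  ∀ t ∈ Icc a b, HasDerivWithinAt θ (pruferF (q t) (θ t)) (Icc a b) t

lemma exists_bound_Icc {a b : ℝ} {q : ℝ → ℝ} (hq : ContinuousOn q (Icc a b)) :
    ∃ M : ℝ, 0 ≤ M ∧ ∀ t ∈ Icc a b, |q t| ≤ M := by
  obtain ⟨M, hM⟩ := isCompact_Icc.exists_bound_of_continuousOn hq
  exact ⟨max M 0, le_max_right _ _, fun t ht => (hM t ht).trans (le_max_left _ _)⟩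

lemma prufer_exists {a b : ℝ} (hab : a < b) {q : ℝ → ℝ} (hq : ContinuousOn q (Icc a b)) (α : ℝ) :
    ∃ θ, θ a = α ∧ IsPrufer q a b θ := by
  obtain ⟨M, hM0, hM⟩ := exists_bound_Icc hq
  have hpl : IsPicardLindelof (fun t θ => pruferF (q t) θ)
      (⟨a, le_rfl, hab.le⟩ : Icc a b) α
      (⟨(M + 1) * (b - a), by have := sub_pos.mpr hab; positivity⟩ : NNReal) 0
      (⟨M + 1, by positivity⟩ : NNReal) (⟨M + 1, by positivity⟩ : NNReal) := by
    refine ⟨fun t ht => ?_, fun θ _ => ?_, fun t ht θ _ => ?_, ?_⟩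
    · apply LipschitzWith.lipschitzOnWith
      apply LipschitzWith.of_dist_le_mul
      intro x y
      rw [Real.dist_eq, Real.dist_eq]
      refine (pruferF_lip _ _ _).trans ?_
      have := hM t ht
      apply mul_le_mul_of_nonneg_right _ (abs_nonneg _)
      change |q t| + 1 ≤ M + 1
      linarith
    · unfold pruferF
      exact continuousOn_const.add (hq.mul continuousOn_const)
    · rw [Real.norm_eq_abs]
      refine (pruferF_bound _ _).trans ?_
      have := hM t ht
      change |q t| + 1 ≤ M + 1
      linarith
    · have : max (b - a) (a - a) = b - a := max_eq_left (by linarith)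
      change (M + 1) * max (b - a) (a - a) ≤ (M + 1) * (b - a) - 0
      rw [this]; linarith
  obtain ⟨θ, h1, h2⟩ := hpl.exists_eq_forall_mem_Icc_hasDerivWithinAt₀
  exact ⟨θ, h1, h2⟩

/-- The sine of a Prüfer angle does not vanish identically. -/
lemma prufer_sin_ne {a b : ℝ} (hab : a < b) {q θ : ℝ → ℝ} (hθ : IsPrufer q a b θ) :
    ∃ t ∈ Icc a b, Real.sin (θ t) ≠ 0 := by
  by_contra! hcon
  have hA : a ∈ Icc a b := ⟨le_rfl, hab.le⟩
  have h1 := (hθ a hA).sin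
  have h2 : HasDerivWithinAt (fun t => Real.sin (θ t)) 0 (Icc a b) a :=
    (hasDerivWithinAt_const a (Icc a b) (0 : ℝ)).congr hcon (hcon a hA)
  have h3 := (uniqueDiffOn_Icc hab a hA).eq_deriv _ h1 h2
  have h4 := hcon a hA
  have h5 := Real.sin_sq_add_cos_sq (θ a)
  unfold pruferF at h3
  rw [h4] at h3 h5
  have h6 : Real.cos (θ a) ^ 2 = 1 := by linarith
  rw [h6] at h3
  have h7 : Real.cos (θ a) = 0 := by linarith
  rw [h7] at h6
  norm_num at h6

lemma prufer_le {a b : ℝ} (hab : a < b) {q₁ q₂ θ₁ θ₂ : ℝ → ℝ}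
    (hq : ContinuousOn q₂ (Icc a b)) (h₁ : IsPrufer q₁ a b θ₁) (h₂ : IsPrufer q₂ a b θ₂)
    (hle : ∀ t ∈ Icc a b, q₁ t ≤ q₂ t) (ha : θ₁ a ≤ θ₂ a) : θ₁ b ≤ θ₂ b :=
  (prufer_compare hab hq h₁ h₂
    (fun t ht => by
      have := mul_le_mul_of_nonneg_right (hle t ht) (sq_nonneg (Real.sin (θ₁ t)))
      unfold pruferF; linarith) (fun t _ => le_rfl) ha).1

lemma prufer_lt {a b : ℝ} (hab : a < b) {q₁ q₂ θ₁ θ₂ : ℝ → ℝ}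
    (hq : ContinuousOn q₂ (Icc a b)) (h₁ : IsPrufer q₁ a b θ₁) (h₂ : IsPrufer q₂ a b θ₂)
    (hlt : ∀ t ∈ Icc a b, q₁ t < q₂ t) (ha : θ₁ a ≤ θ₂ a) : θ₁ b < θ₂ b := by
  have key := prufer_compare hab hq h₁ h₂
    (fun t ht => by
      have := mul_le_mul_of_nonneg_right (hlt t ht).le (sq_nonneg (Real.sin (θ₁ t)))
      unfold pruferF; linarith) (fun t _ => le_rfl) ha
  refine lt_of_le_of_ne key.1 fun heq => ?_
  obtain ⟨t, ht, hs⟩ := prufer_sin_ne hab h₁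
  obtain ⟨e1, e2⟩ := key.2 heq t ht
  rw [← e1] at e2
  unfold pruferF at e2
  have h3 : 0 < Real.sin (θ₁ t) ^ 2 := by positivity
  have := mul_lt_mul_of_pos_right (hlt t ht) h3
  linarith

lemma prufer_pos {a b : ℝ} (hab : a < b) {q θ : ℝ → ℝ}
    (hq : ContinuousOn q (Icc a b)) (hθ : IsPrufer q a b θ) (ha : 0 ≤ θ a) : 0 < θ b := by
  have key := prufer_compare hab hq (θ₁ := fun _ => 0) (p₁ := fun _ => 0)
    (fun t _ => hasDerivWithinAt_const _ _ _) hθ (fun t _ => by simp [pruferF])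
    (fun t _ => le_rfl) ha
  refine lt_of_le_of_ne key.1 fun heq => ?_
  obtain ⟨e1, e2⟩ := key.2 heq a ⟨le_rfl, hab.le⟩
  rw [← e1] at e2
  simp [pruferF] at e2

lemma prufer_le_pi_div_two {a b : ℝ} (hab : a < b) {q θ : ℝ → ℝ}
    (hq : ContinuousOn q (Icc a b)) (hθ : IsPrufer q a b θ) (h0 : ∀ t ∈ Icc a b, q t ≤ 0)
    (ha : θ a ≤ Real.pi / 2) : θ b ≤ Real.pi / 2 :=
  (prufer_compare hab hq hθ (θ₂ := fun _ => Real.pi / 2) (p₂ := fun _ => 0)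
    (fun t _ => hasDerivWithinAt_const _ _ _) (fun t _ => le_rfl)
    (fun t ht => by simpa [pruferF] using h0 t ht) ha).1

lemma prufer_shift {a b : ℝ} {q θ : ℝ → ℝ} (hθ : IsPrufer q a b θ) (m : ℕ) :
    IsPrufer q a b (fun t => θ t + m * Real.pi) := by
  intro t ht
  have h1 := (hθ t ht).add_const (m * Real.pi)
  have h2 : pruferF (q t) (θ t + m * Real.pi) = pruferF (q t) (θ t) := by
    unfold pruferF
    rw [Real.cos_add_nat_mul_pi, Real.sin_add_nat_mul_pi, mul_pow, mul_pow, ← pow_mul,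
      mul_comm m 2, pow_mul]
    simp
  rw [h2]; exact h1

lemma prufer_mono {a b c d : ℝ} {q θ : ℝ → ℝ} (hθ : IsPrufer q a b θ)
    (hs : Icc c d ⊆ Icc a b) : IsPrufer q c d θ :=
  fun t ht => (hθ t (hs ht)).mono hs

/-- Eigenvalue with the boundary condition `u cos α = u' sin α` at both ends. -/
def GenEig (h : ℝ) (Q : ℝ → ℝ) (α a b κ : ℝ) : Prop :=
  ∃ u u' u'' : ℝ → ℝ,
    (∀ x ∈ Icc a b, HasDerivWithinAt u (u' x) (Icc a b) x) ∧
    (∀ x ∈ Icc a b, HasDerivWithinAt u' (u'' x) (Icc a b) x) ∧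
    ContinuousOn u'' (Icc a b) ∧
    (∃ x ∈ Icc a b, u x ≠ 0) ∧
    (∀ x ∈ Icc a b, -h ^ 2 * u'' x + Q x * u x = κ * u x) ∧
    u a * Real.cos α - u' a * Real.sin α = 0 ∧ u b * Real.cos α - u' b * Real.sin α = 0

lemma genEig_zero {h : ℝ} {Q : ℝ → ℝ} {a b κ : ℝ} :
    IsDirichletEigenvalue h Q a b κ ↔ GenEig h Q 0 a b κ := by
  simp [IsDirichletEigenvalue, GenEig]

lemma genEig_pi {h : ℝ} {Q : ℝ → ℝ} {a b κ : ℝ} :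
    IsNeumannEigenvalue h Q a b κ ↔ GenEig h Q (Real.pi / 2) a b κ := by
  simp [IsNeumannEigenvalue, GenEig]

lemma genEig_iff {h : ℝ} (hh : 0 < h) {Q : ℝ → ℝ} {α a b κ : ℝ} (hab : a < b)
    (hQ : ContinuousOn Q (Icc a b)) {θ : ℝ → ℝ} (hα : θ a = α)
    (hθ : IsPrufer (fun t => (κ - Q t) / h ^ 2) a b θ) :
    GenEig h Q α a b κ ↔ Real.sin (θ b - α) = 0 := by
  have hA : a ∈ Icc a b := ⟨le_rfl, hab.le⟩
  have hB : b ∈ Icc a b := ⟨hab.le, le_rfl⟩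
  have hq : ContinuousOn (fun t => (κ - Q t) / h ^ 2) (Icc a b) :=
    (continuousOn_const.sub hQ).div_const _
  set q : ℝ → ℝ := fun t => (κ - Q t) / h ^ 2 with hqdef
  have cθ : ContinuousOn θ (Icc a b) := fun t ht => (hθ t ht).continuousWithinAt
  have cs : ContinuousOn (fun t => Real.sin (θ t)) (Icc a b) :=
    Real.continuous_sin.comp_continuousOn cθ
  have cc : ContinuousOn (fun t => Real.cos (θ t)) (Icc a b) :=
    Real.continuous_cos.comp_continuousOn cθ
  have hc1 : ContinuousOn (fun t => (1 - q t) * (Real.sin (θ t) * Real.cos (θ t))) (Icc a b) :=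
    (continuousOn_const.sub hq).mul (cs.mul cc)
  have hc2 : ContinuousOn (fun t => (q t - 1) * (Real.sin (θ t) * Real.cos (θ t))) (Icc a b) :=
    (hq.sub continuousOn_const).mul (cs.mul cc)
  constructor
  · rintro ⟨u, u', u'', hu, hu', -, ⟨x, hx, hux⟩, hode, ba, bb⟩
    have hu2 : ∀ t ∈ Icc a b, u'' t = -(q t * u t) := fun t ht => by
      have h1 := hode t ht
      have h2 : q t * h ^ 2 = κ - Q t := by
        simp only [hqdef]; field_simp
      have h3 : h ^ 2 * (u'' t + q t * u t) = 0 := by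
        linear_combination -h1 + u t * h2
      have h4 : u'' t + q t * u t = 0 := (mul_eq_zero.mp h3).resolve_left (by positivity)
      linarith
    have hW := linear_zero hab hc2
      (y := fun t => u t * Real.cos (θ t) - u' t * Real.sin (θ t))
      (fun t ht => by
        have h1 := ((hu t ht).mul (hθ t ht).cos).sub ((hu' t ht).mul (hθ t ht).sin)
        refine h1.congr_deriv (Eq.symm ?_)
        rw [hu2 t ht]
        unfold pruferF
        have e := Real.sin_sq_add_cos_sq (θ t)
        generalize Real.sin (θ t) = s at *
        generalize Real.cos (θ t) = c at *
        linear_combination (u' t * c + q t * u t * s) * e) hA (by simpa [hα] using ba)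
    have hRu : ∀ t ∈ Icc a b, u t = (u t * Real.sin (θ t) + u' t * Real.cos (θ t)) * Real.sin (θ t)
        ∧ u' t = (u t * Real.sin (θ t) + u' t * Real.cos (θ t)) * Real.cos (θ t) := fun t ht => by
      have h1 := hW t ht
      have e := Real.sin_sq_add_cos_sq (θ t)
      constructor
      · linear_combination Real.cos (θ t) * h1 - u t * e
      · linear_combination - Real.sin (θ t) * h1 - u' t * e
    have hR : ∀ t ∈ Icc a b, HasDerivWithinAt
        (fun t => u t * Real.sin (θ t) + u' t * Real.cos (θ t))
        ((1 - q t) * (Real.sin (θ t) * Real.cos (θ t)) *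
          (u t * Real.sin (θ t) + u' t * Real.cos (θ t))) (Icc a b) t := fun t ht => by
      have h1 := ((hu t ht).mul (hθ t ht).sin).add ((hu' t ht).mul (hθ t ht).cos)
      refine h1.congr_deriv (Eq.symm ?_)
      rw [hu2 t ht]
      have e := Real.sin_sq_add_cos_sq (θ t)
      have h1 := hW t ht
      unfold pruferF
      generalize Real.sin (θ t) = s at *
      generalize Real.cos (θ t) = c at *
      linear_combination (1 - q t) * (s ^ 2 - c ^ 2) * h1 + (u' t * s - q t * u t * c) * e
    have hRb : u b * Real.sin (θ b) + u' b * Real.cos (θ b) ≠ 0 := fun h0 => by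
      have h1 := linear_zero hab hc1 hR hB h0 x hx
      have h2 := (hRu x hx).1
      rw [h1, zero_mul] at h2
      exact hux h2
    obtain ⟨e1, e2⟩ := hRu b hB
    generalize u b * Real.sin (θ b) + u' b * Real.cos (θ b) = R at *
    rw [e1, e2] at bb
    have : R * Real.sin (θ b - α) = 0 := by
      rw [Real.sin_sub]; linear_combination bb
    exact (mul_eq_zero.mp this).resolve_left hRb
  · intro hs
    obtain ⟨C, hC⟩ := exists_primitive_Icc hab hc1
    have cC : ContinuousOn C (Icc a b) := fun t ht => (hC t ht).continuousWithinAt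
    refine ⟨fun t => Real.exp (C t) * Real.sin (θ t), fun t => Real.exp (C t) * Real.cos (θ t),
      fun t => -(q t * (Real.exp (C t) * Real.sin (θ t))), ?_, ?_, ?_, ?_, ?_, ?_, ?_⟩
    · intro t ht
      have h1 := (hC t ht).exp.mul (hθ t ht).sin
      refine h1.congr_deriv (Eq.symm ?_)
      unfold pruferF
      have e := Real.sin_sq_add_cos_sq (θ t)
      linear_combination -(Real.exp (C t) * Real.cos (θ t)) * e
    · intro t ht
      have h1 := (hC t ht).exp.mul (hθ t ht).cos
      refine h1.congr_deriv (Eq.symm ?_)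
      unfold pruferF
      have e := Real.sin_sq_add_cos_sq (θ t)
      linear_combination (q t * Real.exp (C t) * Real.sin (θ t)) * e
    · exact (hq.mul ((Real.continuous_exp.comp_continuousOn cC).mul cs)).neg
    · obtain ⟨t, ht, hne⟩ := prufer_sin_ne hab hθ
      exact ⟨t, ht, mul_ne_zero (Real.exp_pos _).ne' hne⟩
    · intro t ht
      simp only [hqdef]
      field_simp
      ring
    · simp only [hα]; ring
    · rw [Real.sin_sub] at hs
      linear_combination Real.exp (C b) * hs

/-- Continuous dependence of the final Prüfer angle on the spectral parameter. -/
lemma prufer_continuous {h : ℝ} (hh : 0 < h) {Q : ℝ → ℝ} {α a b : ℝ} (hab : a < b)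
    (hQ : ContinuousOn Q (Icc a b)) {Θ : ℝ → ℝ → ℝ} (hα : ∀ κ, Θ κ a = α)
    (hΘ : ∀ κ, IsPrufer (fun t => (κ - Q t) / h ^ 2) a b (Θ κ)) :
    Continuous (fun κ => Θ κ b) := by
  rw [continuous_iff_continuousAt]
  intro κ₀
  have hq : ContinuousOn (fun t => (κ₀ - Q t) / h ^ 2) (Icc a b) :=
    (continuousOn_const.sub hQ).div_const _
  obtain ⟨M, hM0, hM⟩ := exists_bound_Icc hq
  have hder : ∀ κ, ∀ t ∈ Ico a b, HasDerivWithinAt (Θ κ)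
      (pruferF ((κ - Q t) / h ^ 2) (Θ κ t)) (Ici t) t := fun κ t ht =>
    ((hΘ κ t (Ico_subset_Icc_self ht)).mono (Icc_subset_Icc_left ht.1)).mono_of_mem_nhdsWithin
      (Icc_mem_nhdsGE ht.2)
  have hcont : ∀ κ, ContinuousOn (Θ κ) (Icc a b) := fun κ t ht => (hΘ κ t ht).continuousWithinAt
  have bound : ∀ κ, dist (Θ κ b) (Θ κ₀ b)
      ≤ gronwallBound 0 (M + 1) (|κ - κ₀| / h ^ 2 + 0) (b - a) := fun κ => by
    refine dist_le_of_approx_trajectories_ODE_of_mem (K := ⟨M + 1, by positivity⟩)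
      (v := fun t θ => pruferF ((κ₀ - Q t) / h ^ 2) θ) (s := fun _ => univ)
      (fun t ht => ?_) (hcont κ) (hder κ) (fun t ht => ?_) (fun _ _ => trivial)
      (hcont κ₀) (hder κ₀) (fun t ht => by simp) (fun _ _ => trivial)
      (by simp [hα]) b ⟨hab.le, le_rfl⟩
    · apply LipschitzWith.lipschitzOnWith
      apply LipschitzWith.of_dist_le_mul
      intro x y
      rw [Real.dist_eq, Real.dist_eq]
      refine (pruferF_lip _ _ _).trans ?_
      have := hM t (Ico_subset_Icc_self ht)
      apply mul_le_mul_of_nonneg_right _ (abs_nonneg _)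
      change |(κ₀ - Q t) / h ^ 2| + 1 ≤ M + 1
      linarith
    · rw [Real.dist_eq]
      have e : pruferF ((κ - Q t) / h ^ 2) (Θ κ t) - pruferF ((κ₀ - Q t) / h ^ 2) (Θ κ t)
          = (κ - κ₀) / h ^ 2 * Real.sin (Θ κ t) ^ 2 := by
        unfold pruferF; field_simp; ring
      rw [e, abs_mul, abs_div, abs_of_pos (by positivity : 0 < h ^ 2),
        abs_of_nonneg (sq_nonneg (Real.sin (Θ κ t)))]
      exact mul_le_of_le_one_right (by positivity) (Real.sin_sq_le_one _)
  have hlim : Filter.Tendsto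
      (fun κ => gronwallBound 0 (M + 1) (|κ - κ₀| / h ^ 2 + 0) (b - a)) (nhds κ₀) (nhds 0) := by
    have hc : Continuous (fun κ => gronwallBound 0 (M + 1) (|κ - κ₀| / h ^ 2 + 0) (b - a)) :=
      (gronwallBound_continuous_ε 0 (M + 1) (b - a)).comp
        (g := fun ε => gronwallBound 0 (M + 1) ε (b - a)) (by fun_prop)
    have := hc.tendsto κ₀
    simpa [gronwallBound_ε0_δ0] using this
  rw [ContinuousAt, tendsto_iff_dist_tendsto_zero]
  exact squeeze_zero (fun _ => dist_nonneg) bound hlim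

/-- Counting the level crossings of a continuous increasing function. -/
lemma count_levels {f : ℝ → ℝ} (hc : Continuous f) (hm : StrictMono f) (hpos : ∀ κ, 0 < f κ)
    {β κ₀ : ℝ} (hβ : β ≤ Real.pi) (hβ0 : 0 ≤ β) (h0 : f κ₀ ≤ β) (E : ℝ) {S : Set ℝ}
    (hS : ∀ κ, κ ∈ S ↔ κ ≤ E ∧ ∃ n : ℕ, f κ = β + n * Real.pi) :
    S.Finite ∧ β + ((S.ncard : ℝ) - 1) * Real.pi ≤ f E ∧ f E < β + S.ncard * Real.pi := by
  have hpi := Real.pi_pos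
  obtain ⟨N, hN1, hN2⟩ : ∃ N : ℕ, β + ((N : ℝ) - 1) * Real.pi ≤ f E ∧ f E < β + N * Real.pi := by
    refine ⟨⌊(f E - β) / Real.pi + 1⌋₊, ?_, ?_⟩
    · have h1 : 0 ≤ (f E - β) / Real.pi + 1 := by
        have : (f E - β) / Real.pi + 1 = (f E - β + Real.pi) / Real.pi := by field_simp
        rw [this]
        have := hpos E
        exact div_nonneg (by linarith) hpi.le
      have h2 := Nat.floor_le h1
      have h3 : ((⌊(f E - β) / Real.pi + 1⌋₊ : ℝ) - 1) ≤ (f E - β) / Real.pi := by linarith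
      rw [le_div_iff₀ hpi] at h3
      linarith
    · have h2 := Nat.lt_floor_add_one ((f E - β) / Real.pi + 1)
      have h3 : (f E - β) / Real.pi < (⌊(f E - β) / Real.pi + 1⌋₊ : ℝ) := by linarith
      rw [div_lt_iff₀ hpi] at h3
      linarith
  have hex : ∀ n : ℕ, n < N → ∃ κ, κ ≤ E ∧ f κ = β + n * Real.pi := fun n hn => by
    have h1 : (n : ℝ) + 1 ≤ N := by exact_mod_cast hn
    have h2 : β + n * Real.pi ≤ f E := by
      have := mul_le_mul_of_nonneg_right (by linarith : (n : ℝ) ≤ N - 1) hpi.le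
      linarith
    have h3 : f κ₀ ≤ β + n * Real.pi := by
      have : 0 ≤ (n : ℝ) * Real.pi := by positivity
      linarith
    have h4 : κ₀ ≤ E := hm.le_iff_le.mp (h3.trans h2)
    obtain ⟨κ, hκ, he⟩ := intermediate_value_Icc h4 hc.continuousOn ⟨h3, h2⟩
    exact ⟨κ, hκ.2, he⟩
  choose! g hg1 hg2 using hex
  have hSeq : S = g '' (Finset.range N : Set ℕ) := by
    ext κ
    rw [hS]
    constructor
    · rintro ⟨hκ, n, hn⟩
      have h1 : (n : ℝ) < N := by
        have := hm.monotone hκ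
        by_contra! hcon
        have := mul_le_mul_of_nonneg_right hcon hpi.le
        linarith
      have h2 : n < N := by exact_mod_cast h1
      exact ⟨n, by simpa using h2, hm.injective (by rw [hg2 n h2, hn])⟩
    · rintro ⟨n, hn, rfl⟩
      have hn' : n < N := by simpa using hn
      exact ⟨hg1 n hn', n, hg2 n hn'⟩
  have hinj : Set.InjOn g (Finset.range N : Set ℕ) := fun n hn m hm' he => by
    have h1 : n < N := by simpa using hn
    have h2 : m < N := by simpa using hm'
    have h3 := hg2 n h1
    rw [he, hg2 m h2] at h3
    have h4 : (m : ℝ) * Real.pi = n * Real.pi := by linarith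
    exact_mod_cast (mul_right_cancel₀ hpi.ne' h4).symm
  have hcard : S.ncard = N := by
    rw [hSeq, Set.ncard_image_of_injOn hinj, Set.ncard_coe_finset, Finset.card_range]
  refine ⟨?_, ?_⟩
  · rw [hSeq]; exact (Finset.finite_toSet _).image g
  · rw [hcard]; exact ⟨hN1, hN2⟩

/-- Eigenvalue count in terms of the Prüfer angle at energy `E`. -/
lemma genEig_count {h : ℝ} (hh : 0 < h) {Q : ℝ → ℝ} {α β a b : ℝ} (E : ℝ) (hab : a < b)
    (hQ : ContinuousOn Q (Icc a b)) (hα0 : 0 ≤ α) (hα : α ≤ Real.pi / 2)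
    (hβ : Real.pi / 2 ≤ β) (hβ' : β ≤ Real.pi) (hαβ : β = α ∨ β = α + Real.pi)
    {θ : ℝ → ℝ} (ha : θ a = α) (hθ : IsPrufer (fun t => (E - Q t) / h ^ 2) a b θ) :
    {κ : ℝ | κ ≤ E ∧ GenEig h Q α a b κ}.Finite ∧
    β + (({κ : ℝ | κ ≤ E ∧ GenEig h Q α a b κ}.ncard : ℝ) - 1) * Real.pi ≤ θ b ∧
    θ b < β + {κ : ℝ | κ ≤ E ∧ GenEig h Q α a b κ}.ncard * Real.pi := by
  have hpi := Real.pi_pos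
  have hq : ∀ κ, ContinuousOn (fun t => (κ - Q t) / h ^ 2) (Icc a b) := fun κ =>
    (continuousOn_const.sub hQ).div_const _
  choose Θ hΘa hΘ using fun κ => prufer_exists hab (hq κ) α
  have hE : Θ E b = θ b := le_antisymm
    (prufer_le hab (hq E) (hΘ E) hθ (fun _ _ => le_rfl) (by rw [hΘa, ha]))
    (prufer_le hab (hq E) hθ (hΘ E) (fun _ _ => le_rfl) (by rw [hΘa, ha]))
  have hpos : ∀ κ, 0 < Θ κ b := fun κ => prufer_pos hab (hq κ) (hΘ κ) (by rw [hΘa]; exact hα0)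
  have hmono : StrictMono (fun κ => Θ κ b) := fun κ₁ κ₂ hlt =>
    prufer_lt hab (hq κ₂) (hΘ κ₁) (hΘ κ₂)
      (fun t _ => div_lt_div_of_pos_right (by linarith) (by positivity)) (by rw [hΘa, hΘa])
  obtain ⟨M, hM0, hM⟩ := exists_bound_Icc hQ
  have hlow : Θ (-M) b ≤ β := (prufer_le_pi_div_two hab (hq (-M)) (hΘ (-M))
    (fun t ht => by
      have := (abs_le.mp (hM t ht)).1
      exact div_nonpos_of_nonpos_of_nonneg (by linarith) (by positivity))
    (by rw [hΘa]; exact hα)).trans hβ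
  rw [← hE]
  refine count_levels (prufer_continuous hh hab hQ hΘa hΘ) hmono hpos hβ' (by linarith) hlow E
    (fun κ => ?_)
  simp only [mem_setOf_eq]
  refine and_congr_right fun _ => ?_
  rw [genEig_iff hh hab hQ (hΘa κ) (hΘ κ), Real.sin_eq_zero_iff]
  constructor
  · rintro ⟨n, hn⟩
    have h1 := hpos κ
    rcases hαβ with rfl | rfl
    · have h2 : (-1 : ℝ) < n := by
        by_contra! hcon
        have := mul_le_mul_of_nonneg_right hcon hpi.le
        linarith
      have h3 : (-1 : ℤ) < n := by exact_mod_cast h2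
      obtain ⟨m, rfl⟩ := Int.eq_ofNat_of_zero_le (by omega : 0 ≤ n)
      refine ⟨m, ?_⟩
      push_cast at hn
      linarith
    · have h2 : (0 : ℝ) < n := by
        by_contra! hcon
        have := mul_le_mul_of_nonneg_right hcon hpi.le
        linarith
      have h3 : (0 : ℤ) < n := by exact_mod_cast h2
      obtain ⟨m, hm⟩ := Int.eq_ofNat_of_zero_le (by omega : 0 ≤ n - 1)
      refine ⟨m, ?_⟩
      have h4 : (n : ℝ) = m + 1 := by
        have : n = m + 1 := by omega
        rw [this]; push_cast; ring
      rw [h4] at hn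
      linarith
  · rintro ⟨n, hn⟩
    rcases hαβ with rfl | rfl
    · exact ⟨n, by push_cast; linarith⟩
    · exact ⟨n + 1, by push_cast; linarith⟩

lemma dirichlet_count {h : ℝ} (hh : 0 < h) {Q : ℝ → ℝ} {a b : ℝ} (E : ℝ) (hab : a < b)
    (hQ : ContinuousOn Q (Icc a b))
    {θ : ℝ → ℝ} (ha : θ a = 0) (hθ : IsPrufer (fun t => (E - Q t) / h ^ 2) a b θ) :
    {κ : ℝ | κ ≤ E ∧ IsDirichletEigenvalue h Q a b κ}.Finite ∧
    ({κ : ℝ | κ ≤ E ∧ IsDirichletEigenvalue h Q a b κ}.ncard : ℝ) * Real.pi ≤ θ b ∧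
    θ b < (({κ : ℝ | κ ≤ E ∧ IsDirichletEigenvalue h Q a b κ}.ncard : ℝ) + 1) * Real.pi := by
  have hpi := Real.pi_pos
  simp only [genEig_zero]
  obtain ⟨h1, h2, h3⟩ := genEig_count (β := Real.pi) hh E hab hQ le_rfl (by linarith)
    (by linarith) le_rfl (Or.inr (by ring)) ha hθ
  exact ⟨h1, by linarith, by linarith⟩

lemma neumann_count {h : ℝ} (hh : 0 < h) {Q : ℝ → ℝ} {a b : ℝ} (E : ℝ) (hab : a < b)
    (hQ : ContinuousOn Q (Icc a b))
    {θ : ℝ → ℝ} (ha : θ a = Real.pi / 2)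
    (hθ : IsPrufer (fun t => (E - Q t) / h ^ 2) a b θ) :
    {κ : ℝ | κ ≤ E ∧ IsNeumannEigenvalue h Q a b κ}.Finite ∧
    θ b < Real.pi / 2 + {κ : ℝ | κ ≤ E ∧ IsNeumannEigenvalue h Q a b κ}.ncard * Real.pi := by
  have hpi := Real.pi_pos
  simp only [genEig_pi]
  obtain ⟨h1, h2, h3⟩ := genEig_count (β := Real.pi / 2) hh E hab hQ (by linarith) le_rfl
    le_rfl (by linarith) (Or.inl rfl) ha hθ
  exact ⟨h1, h3⟩

/-- Dirichlet–Neumann bracketing (the key step in the proof of Weyl's law, Lemma 4.2 of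
the paper): partitioning `[x₀, x_k]` into `k` cells `[x_{i-1}, x_i]` and replacing `V`
on each cell by its maximum `V⁺ᵢ` (Dirichlet conditions) or minimum `V⁻ᵢ` (Neumann
conditions), the number `D` of Dirichlet eigenvalues `κ ≤ E` of `−h²(d/dx)² + V` on
`[x₀, x_k]` is finite and satisfies `Σᵢ D⁺ᵢ ≤ D ≤ Σᵢ N⁻ᵢ`. -/
theorem dirichlet_neumann_bracketing
    (h E : ℝ) (hh : 0 < h)
    (k : ℕ) (hk : 0 < k)
    (x : ℕ → ℝ) (hmono : ∀ i < k, x i < x (i + 1))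
    (V : ℝ → ℝ) (hV : ContinuousOn V (Icc (x 0) (x k))) :
    {κ : ℝ | κ ≤ E ∧ IsDirichletEigenvalue h V (x 0) (x k) κ}.Finite ∧
    (∀ i < k,
      {κ : ℝ | κ ≤ E ∧
        IsDirichletEigenvalue h (fun _ => sSup (V '' Icc (x i) (x (i + 1))))
          (x i) (x (i + 1)) κ}.Finite ∧
      {κ : ℝ | κ ≤ E ∧
        IsNeumannEigenvalue h (fun _ => sInf (V '' Icc (x i) (x (i + 1))))
          (x i) (x (i + 1)) κ}.Finite) ∧
    (∑ i ∈ Finset.range k,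
        {κ : ℝ | κ ≤ E ∧
          IsDirichletEigenvalue h (fun _ => sSup (V '' Icc (x i) (x (i + 1))))
            (x i) (x (i + 1)) κ}.ncard)
      ≤ {κ : ℝ | κ ≤ E ∧ IsDirichletEigenvalue h V (x 0) (x k) κ}.ncard ∧
    {κ : ℝ | κ ≤ E ∧ IsDirichletEigenvalue h V (x 0) (x k) κ}.ncard
      ≤ ∑ i ∈ Finset.range k,
          {κ : ℝ | κ ≤ E ∧
            IsNeumannEigenvalue h (fun _ => sInf (V '' Icc (x i) (x (i + 1))))
              (x i) (x (i + 1)) κ}.ncard := by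
  have hpi := Real.pi_pos
  have hle : ∀ i j, i ≤ j → j ≤ k → x i ≤ x j := fun i j hij => by
    induction j, hij using Nat.le_induction with
    | base => exact fun _ => le_rfl
    | succ n hn ih => exact fun hj => (ih (by omega)).trans (hmono n (by omega)).le
  have hsub : ∀ i < k, Icc (x i) (x (i + 1)) ⊆ Icc (x 0) (x k) := fun i hi =>
    Icc_subset_Icc (hle 0 i (by omega) (by omega)) (hle (i + 1) k (by omega) le_rfl)
  have h0k : x 0 < x k := (hmono 0 hk).trans_le (hle 1 k (by omega) le_rfl)
  have hq : ContinuousOn (fun t => (E - V t) / h ^ 2) (Icc (x 0) (x k)) :=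
    (continuousOn_const.sub hV).div_const _
  obtain ⟨θ, hθ0, hθ⟩ := prufer_exists h0k hq 0
  obtain ⟨hfin, hD1, hD2⟩ := dirichlet_count hh E h0k hV hθ0 hθ
  have hsup : ∀ i < k, ∀ t ∈ Icc (x i) (x (i + 1)),
      V t ≤ sSup (V '' Icc (x i) (x (i + 1))) := fun i hi t ht =>
    le_csSup (isCompact_Icc.image_of_continuousOn (hV.mono (hsub i hi))).bddAbove
      (mem_image_of_mem V ht)
  have hinf : ∀ i < k, ∀ t ∈ Icc (x i) (x (i + 1)),
      sInf (V '' Icc (x i) (x (i + 1))) ≤ V t := fun i hi t ht =>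
    csInf_le (isCompact_Icc.image_of_continuousOn (hV.mono (hsub i hi))).bddBelow
      (mem_image_of_mem V ht)
  have hcell : ∀ i < k,
      ({κ : ℝ | κ ≤ E ∧
        IsDirichletEigenvalue h (fun _ => sSup (V '' Icc (x i) (x (i + 1))))
          (x i) (x (i + 1)) κ}.Finite ∧
      {κ : ℝ | κ ≤ E ∧
        IsNeumannEigenvalue h (fun _ => sInf (V '' Icc (x i) (x (i + 1))))
          (x i) (x (i + 1)) κ}.Finite) ∧
      (∀ m : ℕ, (m : ℝ) * Real.pi ≤ θ (x i) →
        ((m + {κ : ℝ | κ ≤ E ∧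
        IsDirichletEigenvalue h (fun _ => sSup (V '' Icc (x i) (x (i + 1))))
          (x i) (x (i + 1)) κ}.ncard : ℕ) : ℝ) * Real.pi ≤ θ (x (i + 1))) ∧
      (∀ m : ℕ, θ (x i) ≤ Real.pi / 2 + m * Real.pi → θ (x (i + 1)) ≤ Real.pi / 2 +
        ((m + {κ : ℝ | κ ≤ E ∧
        IsNeumannEigenvalue h (fun _ => sInf (V '' Icc (x i) (x (i + 1))))
          (x i) (x (i + 1)) κ}.ncard : ℕ) : ℝ) * Real.pi) := by
    intro i hi
    have hlt := hmono i hi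
    have hq' := hq.mono (hsub i hi)
    have hθ' := prufer_mono hθ (hsub i hi)
    have hc1 : ∀ c : ℝ, ContinuousOn (fun _ : ℝ => (E - c) / h ^ 2) (Icc (x i) (x (i + 1))) :=
      fun c => continuousOn_const
    obtain ⟨φ, hφ0, hφ⟩ := prufer_exists hlt (hc1 (sSup (V '' Icc (x i) (x (i + 1))))) 0
    obtain ⟨ψ, hψ0, hψ⟩ := prufer_exists hlt (hc1 (sInf (V '' Icc (x i) (x (i + 1)))))
      (Real.pi / 2)
    obtain ⟨f1, f2, -⟩ := dirichlet_count hh E hlt continuousOn_const hφ0 hφ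
    obtain ⟨g1, g2⟩ := neumann_count hh E hlt continuousOn_const hψ0 hψ
    refine ⟨⟨f1, g1⟩, fun m hm => ?_, fun m hm => ?_⟩
    · have := prufer_le hlt hq' (prufer_shift hφ m) hθ'
        (fun t ht => div_le_div_of_nonneg_right (by linarith [hsup i hi t ht]) (by positivity))
        (by simp only [hφ0]; linarith)
      push_cast
      linarith
    · have := prufer_le hlt (hc1 _) hθ' (prufer_shift hψ m)
        (fun t ht => div_le_div_of_nonneg_right (by linarith [hinf i hi t ht]) (by positivity))
        (by simp only [hψ0]; linarith)
      push_cast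
      linarith
  have hlow : ∀ j ≤ k, ((∑ i ∈ Finset.range j,
        {κ : ℝ | κ ≤ E ∧
          IsDirichletEigenvalue h (fun _ => sSup (V '' Icc (x i) (x (i + 1))))
            (x i) (x (i + 1)) κ}.ncard : ℕ) : ℝ) * Real.pi ≤ θ (x j) := by
    intro j
    induction j with
    | zero => intro _; simp [hθ0]
    | succ n ih =>
      intro hn
      rw [Finset.sum_range_succ]
      exact (hcell n (by omega)).2.1 _ (ih (by omega))
  have hupp : ∀ j ≤ k, θ (x j) ≤ Real.pi / 2 + ((∑ i ∈ Finset.range j,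
        {κ : ℝ | κ ≤ E ∧
          IsNeumannEigenvalue h (fun _ => sInf (V '' Icc (x i) (x (i + 1))))
            (x i) (x (i + 1)) κ}.ncard : ℕ) : ℝ) * Real.pi := by
    intro j
    induction j with
    | zero => intro _; simp [hθ0]; positivity
    | succ n ih =>
      intro hn
      rw [Finset.sum_range_succ]
      exact (hcell n (by omega)).2.2 _ (ih (by omega))
  refine ⟨hfin, fun i hi => (hcell i hi).1, ?_, ?_⟩
  · have h1 := (hlow k le_rfl).trans_lt hD2
    have h2 := lt_of_mul_lt_mul_right h1 hpi.le
    exact Nat.lt_succ_iff.mp (by exact_mod_cast h2)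
  · have h1 := hD1.trans (hupp k le_rfl)
    by_contra! hcon
    have h2 : ((∑ i ∈ Finset.range k,
        {κ : ℝ | κ ≤ E ∧
          IsNeumannEigenvalue h (fun _ => sInf (V '' Icc (x i) (x (i + 1))))
            (x i) (x (i + 1)) κ}.ncard : ℕ) : ℝ) + 1
        ≤ {κ : ℝ | κ ≤ E ∧ IsDirichletEigenvalue h V (x 0) (x k) κ}.ncard := by
      exact_mod_cast hcon
    have h3 := mul_le_mul_of_nonneg_right h2 hpi.le
    linarith
end

section
/- Let R > 0 and σ > 0. Let V_ind : ℝ → ℝ be continuous on [0,R] and V_flat : ℝ → ℝ be continuously differentiable on [0,R] with 0 ≤ V_flat(x) ≤ V_ind(x) for all x ∈ [0,R]. Define g : [0,R] → ℝ by g(x) := exp( −2σ ∫_x^R V_ind(y) dy ). Then for every u : ℝ → ℂ continuously differentiable on [0,R] with u(0) = 0, we have ∫_0^R (g·V_flat)'(x) |u(x)|² dx ≤ (1/2) ∫_0^R g'(x) ( |u'(x)|² + σ⁻² |u(x)|² ) dx + g(R) V_ind(R) |u(R)|². -/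
open Set MeasureTheory

/-- The exponential-weight multiplier inequality used for intermediate time frequencies
(Section 5.4.4 of the paper): with the weight `g(x) = exp(−2σ ∫_x^R V_ind)`, which
satisfies `g' = 2σ V_ind g`, and `0 ≤ V_flat ≤ V_ind`, one has for `u` vanishing at `0`:
`∫₀^R (g V_flat)' |u|² ≤ (1/2) ∫₀^R g' (|u'|² + σ⁻² |u|²) + g(R) V_ind(R) |u(R)|²`.
Here `(g V_flat)'(x) = g(x)(2σ V_ind(x) V_flat(x) + V_flat'(x))`. -/
theorem exponential_weight_multiplier
    (R σ : ℝ) (hR : 0 < R) (hσ : 0 < σ)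
    (Vind Vflat Vflat' : ℝ → ℝ)
    (hVind : ContinuousOn Vind (Icc (0:ℝ) R))
    (hVflat : ∀ x ∈ Icc (0:ℝ) R, HasDerivWithinAt Vflat (Vflat' x) (Icc (0:ℝ) R) x)
    (hVflat' : ContinuousOn Vflat' (Icc (0:ℝ) R))
    (hV0 : ∀ x ∈ Icc (0:ℝ) R, 0 ≤ Vflat x ∧ Vflat x ≤ Vind x)
    (u u' : ℝ → ℂ)
    (hu : ∀ x ∈ Icc (0:ℝ) R, HasDerivWithinAt u (u' x) (Icc (0:ℝ) R) x)
    (hu' : ContinuousOn u' (Icc (0:ℝ) R))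
    (hu0 : u 0 = 0) :
    (∫ x in (0:ℝ)..R,
        (Real.exp (-2 * σ * ∫ y in x..R, Vind y)
            * (2 * σ * Vind x * Vflat x + Vflat' x)) * ‖u x‖ ^ 2)
      ≤ (1 / 2) * (∫ x in (0:ℝ)..R,
          (2 * σ * Vind x * Real.exp (-2 * σ * ∫ y in x..R, Vind y))
            * (‖u' x‖ ^ 2 + (σ ^ 2)⁻¹ * ‖u x‖ ^ 2))
        + Real.exp (-2 * σ * ∫ y in R..R, Vind y) * Vind R * ‖u R‖ ^ 2 := by
  set g : ℝ → ℝ := fun x => Real.exp (-2 * σ * ∫ y in x..R, Vind y) with hg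
  have hRle := hR.le
  have huc : ContinuousOn u (Icc (0:ℝ) R) := fun x hx => (hu x hx).continuousWithinAt
  have hfc : ContinuousOn Vflat (Icc (0:ℝ) R) := fun x hx => (hVflat x hx).continuousWithinAt
  have hGc : ContinuousOn (fun x => ∫ y in x..R, Vind y) (Icc (0:ℝ) R) := by
    have h := intervalIntegral.continuousOn_primitive_interval_left (μ := volume) (f := Vind)
      (a := 0) (b := R) (by rw [uIcc_of_le hRle]; exact hVind.integrableOn_Icc)
    rwa [uIcc_of_le hRle] at h
  have hgc : ContinuousOn g (Icc (0:ℝ) R) := by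
    rw [hg]; fun_prop
  have hgd : ∀ x ∈ Ioo (0:ℝ) R, HasDerivAt g (g x * (2 * σ * Vind x)) x := by
    intro x hx
    have h1 : HasDerivAt (fun x => ∫ y in x..R, Vind y) (-Vind x) x := by
      apply intervalIntegral.integral_hasDerivAt_left
      · apply ContinuousOn.intervalIntegrable
        rw [uIcc_of_le hx.2.le]
        exact hVind.mono (Icc_subset_Icc_left hx.1.le)
      · exact (hVind.mono Ioo_subset_Icc_self).stronglyMeasurableAtFilter isOpen_Ioo x hx
      · exact hVind.continuousAt (Icc_mem_nhds hx.1 hx.2)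
    have h2 := (h1.const_mul (-2 * σ)).exp
    convert h2 using 1
    simp only [hg]; ring
  have hFd : ∀ x ∈ Ioo (0:ℝ) R, HasDerivAt (fun x => g x * Vflat x * ‖u x‖ ^ 2)
      ((g x * (2 * σ * Vind x * Vflat x + Vflat' x)) * ‖u x‖ ^ 2
        + g x * Vflat x * (2 * inner ℝ (u x) (u' x))) x := by
    intro x hx
    have hn := Icc_mem_nhds hx.1 hx.2
    have hm := Ioo_subset_Icc_self hx
    have h := ((hgd x hx).mul ((hVflat x hm).hasDerivAt hn)).mul
      ((hu x hm).hasDerivAt hn).norm_sq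
    refine h.congr_deriv ?_
    simp only [Pi.mul_apply]
    ring
  have hi1 : IntervalIntegrable (fun x => (g x * (2 * σ * Vind x * Vflat x + Vflat' x))
      * ‖u x‖ ^ 2) volume 0 R := by
    apply ContinuousOn.intervalIntegrable
    rw [uIcc_of_le hRle]; fun_prop
  have hi2 : IntervalIntegrable (fun x => g x * Vflat x * (2 * inner ℝ (u x) (u' x)))
      volume 0 R := by
    apply ContinuousOn.intervalIntegrable
    rw [uIcc_of_le hRle]
    exact (hgc.mul hfc).mul (continuousOn_const.mul (ContinuousOn.inner (𝕜 := ℝ) huc hu'))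
  have hi3 : IntervalIntegrable (fun x => (2 * σ * Vind x * g x)
      * (‖u' x‖ ^ 2 + (σ ^ 2)⁻¹ * ‖u x‖ ^ 2)) volume 0 R := by
    apply ContinuousOn.intervalIntegrable
    rw [uIcc_of_le hRle]; fun_prop
  have hftc := intervalIntegral.integral_eq_sub_of_hasDerivAt_of_le hRle
    (f := fun x => g x * Vflat x * ‖u x‖ ^ 2) (by fun_prop) hFd (hi1.add hi2)
  have hmono := intervalIntegral.integral_mono_on hRle hi1
    ((hi1.add hi2).add (hi3.const_mul (1/2))) (by
      intro x hx
      have hgp : 0 < g x := Real.exp_pos _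
      obtain ⟨h0, h1⟩ := hV0 x hx
      have hin : -(‖u x‖ * ‖u' x‖) ≤ inner ℝ (u x) (u' x) :=
        (abs_le.1 (abs_real_inner_le_norm (u x) (u' x))).1
      have hy : 2 * (‖u x‖ * ‖u' x‖) ≤ σ * (‖u' x‖ ^ 2 + (σ ^ 2)⁻¹ * ‖u x‖ ^ 2) := by
        have : σ * (‖u' x‖ ^ 2 + (σ ^ 2)⁻¹ * ‖u x‖ ^ 2) - 2 * (‖u x‖ * ‖u' x‖)
            = σ * (‖u' x‖ - σ⁻¹ * ‖u x‖) ^ 2 := by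
          field_simp
          ring
        have : 0 ≤ σ * (‖u' x‖ - σ⁻¹ * ‖u x‖) ^ 2 := by positivity
        linarith
      have ha : g x * Vflat x * (-(2 * (‖u x‖ * ‖u' x‖)))
          ≤ g x * Vflat x * (2 * inner ℝ (u x) (u' x)) :=
        mul_le_mul_of_nonneg_left (by linarith) (by positivity)
      have hb : g x * Vflat x * (2 * (‖u x‖ * ‖u' x‖))
          ≤ g x * Vind x * (σ * (‖u' x‖ ^ 2 + (σ ^ 2)⁻¹ * ‖u x‖ ^ 2)) := by
        have := h0.trans h1
        gcongr
      linarith)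
  rw [intervalIntegral.integral_add (hi1.add hi2) (hi3.const_mul (1/2)),
    intervalIntegral.integral_const_mul] at hmono
  have hend : g R * Vflat R * ‖u R‖ ^ 2 ≤ g R * Vind R * ‖u R‖ ^ 2 := by
    have hgp : 0 < g R := Real.exp_pos _
    have := (hV0 R ⟨hRle, le_rfl⟩).2
    gcongr
  simp only [hu0, norm_zero] at hftc
  change _ ≤ _ + g R * Vind R * ‖u R‖ ^ 2
  rw [hftc] at hmono
  linarith
end

section
/- Let I ⊆ ℝ be an open interval, ω ∈ ℝ, let V : ℝ → ℝ be continuously differentiable on I, let u : ℝ → ℂ be twice continuously differentiable on I, and let H : ℝ → ℂ be continuous on I with u''(x) + (ω² − V(x))u(x) = H(x) for all x ∈ I. Let f, w, g : ℝ → ℝ be respectively three times, twice, and once continuously differentiable on I, and define on I: Q₀(x) := f(x)(|u'(x)|² + (ω² − V(x))|u(x)|²) + f'(x)·Re(u'(x)·conj(u(x))) − (1/2)f''(x)|u(x)|², Q₁(x) := w(x)·Re(u'(x)·conj(u(x))) − (1/2)w'(x)|u(x)|², and Q₂(x) := g(x)(|u'(x)|² + (ω² − V(x))|u(x)|²). Then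 for all x ∈ I: Q₀'(x) = 2f'(x)|u'(x)|² − (f(x)V'(x) + (1/2)f'''(x))|u(x)|² + 2f(x)·Re(conj(u'(x))·H(x)) + f'(x)·Re(conj(u(x))·H(x)); Q₁'(x) = w(x)( |u'(x)|² − ω²|u(x)|² + V(x)|u(x)|² + Re(conj(u(x))·H(x)) ) − (1/2)w''(x)|u(x)|²; and Q₂'(x) = g'(x)( |u'(x)|² + (ω² − V(x))|u(x)|² ) − g(x)V'(x)|u(x)|² + 2g(x)·Re(conj(u'(x))·H(x)). -/
open Set MeasureTheory Complex

/-- The three frequency-localised current identities (Section 5.4.2 of the paper):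
for `u` solving the inhomogeneous reduced equation `u'' + (ω² − V)u = H` on an open
interval `I`, the currents
`Q₀ = f(|u'|² + (ω²−V)|u|²) + f' Re(u' ū) − ½ f'' |u|²`,
`Q₁ = w Re(u' ū) − ½ w' |u|²`,
`Q₂ = g(|u'|² + (ω²−V)|u|²)`
have the derivatives stated in the paper. -/
theorem frequency_localised_current_identities
    (I : Set ℝ) (hIopen : IsOpen I) (hIconn : I.OrdConnected)
    (ω : ℝ)
    (V V' : ℝ → ℝ)
    (hV : ∀ x ∈ I, HasDerivAt V (V' x) x)
    (hV'cont : ContinuousOn V' I)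
    (u u' u'' : ℝ → ℂ)
    (hu : ∀ x ∈ I, HasDerivAt u (u' x) x)
    (hu' : ∀ x ∈ I, HasDerivAt u' (u'' x) x)
    (hu''cont : ContinuousOn u'' I)
    (H : ℝ → ℂ) (hHcont : ContinuousOn H I)
    (heq : ∀ x ∈ I, u'' x + (↑(ω ^ 2 - V x) : ℂ) * u x = H x)
    (f f' f'' f''' : ℝ → ℝ)
    (hf : ∀ x ∈ I, HasDerivAt f (f' x) x)
    (hf' : ∀ x ∈ I, HasDerivAt f' (f'' x) x)
    (hf'' : ∀ x ∈ I, HasDerivAt f'' (f''' x) x)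
    (hf'''cont : ContinuousOn f''' I)
    (w w' w'' : ℝ → ℝ)
    (hw : ∀ x ∈ I, HasDerivAt w (w' x) x)
    (hw' : ∀ x ∈ I, HasDerivAt w' (w'' x) x)
    (hw''cont : ContinuousOn w'' I)
    (g g' : ℝ → ℝ)
    (hg : ∀ x ∈ I, HasDerivAt g (g' x) x)
    (hg'cont : ContinuousOn g' I) :
    ∀ x ∈ I,
      HasDerivAt (fun y =>
          f y * (‖u' y‖ ^ 2 + (ω ^ 2 - V y) * ‖u y‖ ^ 2)
            + f' y * (u' y * (starRingEnd ℂ) (u y)).re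
            - (1 / 2) * f'' y * ‖u y‖ ^ 2)
        (2 * f' x * ‖u' x‖ ^ 2
          - (f x * V' x + (1 / 2) * f''' x) * ‖u x‖ ^ 2
          + 2 * f x * ((starRingEnd ℂ) (u' x) * H x).re
          + f' x * ((starRingEnd ℂ) (u x) * H x).re) x ∧
      HasDerivAt (fun y =>
          w y * (u' y * (starRingEnd ℂ) (u y)).re
            - (1 / 2) * w' y * ‖u y‖ ^ 2)
        (w x * (‖u' x‖ ^ 2 - ω ^ 2 * ‖u x‖ ^ 2 + V x * ‖u x‖ ^ 2
              + ((starRingEnd ℂ) (u x) * H x).re)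
          - (1 / 2) * w'' x * ‖u x‖ ^ 2) x ∧
      HasDerivAt (fun y =>
          g y * (‖u' y‖ ^ 2 + (ω ^ 2 - V y) * ‖u y‖ ^ 2))
        (g' x * (‖u' x‖ ^ 2 + (ω ^ 2 - V x) * ‖u x‖ ^ 2)
          - g x * V' x * ‖u x‖ ^ 2
          + 2 * g x * ((starRingEnd ℂ) (u' x) * H x).re) x := by
  intro x hx
  have re_d : ∀ (v : ℝ → ℂ) (c : ℂ), HasDerivAt v c x →
      HasDerivAt (fun y => (v y).re) c.re x := fun v c h =>
    (Complex.reCLM.hasFDerivAt (x := v x)).comp_hasDerivAt x h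
  have im_d : ∀ (v : ℝ → ℂ) (c : ℂ), HasDerivAt v c x →
      HasDerivAt (fun y => (v y).im) c.im x := fun v c h =>
    (Complex.imCLM.hasFDerivAt (x := v x)).comp_hasDerivAt x h
  have a := re_d u _ (hu x hx)
  have b := im_d u _ (hu x hx)
  have a' := re_d u' _ (hu' x hx)
  have b' := im_d u' _ (hu' x hx)
  have hH := heq x hx
  have h1 : (H x).re = (u'' x).re + (ω ^ 2 - V x) * (u x).re := by
    rw [← hH, Complex.add_re, Complex.re_ofReal_mul]
  have h2 : (H x).im = (u'' x).im + (ω ^ 2 - V x) * (u x).im := by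
    rw [← hH, Complex.add_im, Complex.im_ofReal_mul]
  have N := (a.mul a).add (b.mul b)
  have N' := (a'.mul a').add (b'.mul b')
  have R := (a'.mul a).add (b'.mul b)
  have P := N'.add (((hV x hx).const_sub (ω ^ 2)).mul N)
  simp only [Complex.sq_norm, Complex.normSq_apply, Complex.mul_re, Complex.conj_re,
    Complex.conj_im, h1, h2]
  refine ⟨?_, ?_, ?_⟩
  · refine ((((hf x hx).mul P).add ((hf' x hx).mul R)).sub
      (((hf'' x hx).const_mul (1 / 2)).mul N)).congr_deriv ?_ |>.congr_of_eventuallyEq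
      (Filter.Eventually.of_forall fun y => ?_)
    · simp only [Pi.add_apply, Pi.mul_apply]; ring
    · simp only [Pi.add_apply, Pi.mul_apply, Pi.sub_apply]; ring
  · refine (((hw x hx).mul R).sub
      (((hw' x hx).const_mul (1 / 2)).mul N)).congr_deriv ?_ |>.congr_of_eventuallyEq
      (Filter.Eventually.of_forall fun y => ?_)
    · simp only [Pi.add_apply, Pi.mul_apply]; ring
    · simp only [Pi.add_apply, Pi.mul_apply, Pi.sub_apply]; ring
  · refine ((hg x hx).mul P).congr_deriv ?_ |>.congr_of_eventuallyEq
      (Filter.Eventually.of_forall fun y => ?_)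
    · simp only [Pi.add_apply, Pi.mul_apply]; ring
    · simp only [Pi.add_apply, Pi.mul_apply]
end
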